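/- arXiv:1304.8127 — 7 statements merged into one kernel-verified Lean document; each statement's English description precedes it below -/
import Mathlib

section
/- Let B_2 and B_3 be nonempty finite words over an alphabet with gcd(|B_2|, |B_3|) = 1, set g = 2|B_2||B_3|, and let W be any finite word. Then for every natural number r with |W| + g ≤ r ≤ |W| + 5g|B_2| + 5g|B_3| − g, the word B_2^{5g} * W * B_3^{5g} has a factor w with |w| = r of the form w = B_2 * m * B_3 for some (possibly empty) word m. -/
open Finset MeasureTheory

namespace IETPaper

/-- The first index `0` of `Fin d` (corresponding to `1` in `{1,…,d}`). -/
def firstIdx (d : ℕ) [NeZero d] : Fin d := ⟨0, Nat.pos_of_ne_zero (NeZero.ne d)⟩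

/-- The last index `d-1` of `Fin d` (corresponding to `d` in `{1,…,d}`). -/
def lastIdx (d : ℕ) [NeZero d] : Fin d :=
  ⟨d - 1, Nat.sub_lt (Nat.pos_of_ne_zero (NeZero.ne d)) one_pos⟩

/-- Left endpoint `l₁ + ⋯ + l_{j-1}` of the `j`-th interval `I_j`. -/
noncomputable def leftEnd {d : ℕ} (L : Fin d → ℝ) (j : Fin d) : ℝ :=
  ∑ k ∈ Finset.univ.filter (fun k => k < j), L k

/-- The interval exchange transformation `T_{L,π}`: on the interval
`I_j = [leftEnd L j, leftEnd L j + L j)` it is the translation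
`x ↦ x - ∑_{k < j} l_k + ∑_{π k' < π j} l_{k'}`; elsewhere it is the identity. -/
noncomputable def ietMap {d : ℕ} (π : Equiv.Perm (Fin d)) (L : Fin d → ℝ) (x : ℝ) : ℝ :=
  if h : ∃ j : Fin d, x ∈ Set.Ico (leftEnd L j) (leftEnd L j + L j) then
    x - leftEnd L h.choose + ∑ k ∈ Finset.univ.filter (fun k => π k < π h.choose), L k
  else x

/-- Topological mixing of `T` on the subspace `X ⊆ ℝ` (with its subspace topology:
open sets of `X` are exactly the sets `U ∩ X` with `U` open in `ℝ`). -/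
def TopMixingOn (T : ℝ → ℝ) (X : Set ℝ) : Prop :=
  ∀ U V : Set ℝ, IsOpen U → IsOpen V → (U ∩ X).Nonempty → (V ∩ X).Nonempty →
    ∃ N : ℕ, ∀ n : ℕ, N ≤ n → ((T^[n] '' (U ∩ X)) ∩ (V ∩ X)).Nonempty

/-- Irreducibility of a permutation: `π {1,…,k} ≠ {1,…,k}` for all `k < d`
(0-indexed: `π` does not preserve `{j | j < k}` for `0 < k < d`). -/
def IsIrreducible {d : ℕ} (π : Equiv.Perm (Fin d)) : Prop :=
  ∀ k : ℕ, 0 < k → k < d →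
    (⇑π '' {j : Fin d | (j : ℕ) < k}) ≠ {j : Fin d | (j : ℕ) < k}

/-- A permutation of `{1,…,d}` (written 0-indexed on `Fin d`) is degenerate if for some
`1 ≤ j < d` (0-indexed: `j + 1 < d`) one of the four listed conditions holds. -/
def IsDegenerate {d : ℕ} (π : Equiv.Perm (Fin d)) : Prop :=
  ∃ j : ℕ, ∃ hj : j + 1 < d,
    ((π ⟨j + 1, hj⟩ : ℕ) = (π ⟨j, by omega⟩ : ℕ) + 1) ∨
    ((π ⟨j, by omega⟩ : ℕ) = d - 1 ∧ (π ⟨j + 1, hj⟩ : ℕ) = 0 ∧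
      (π ⟨0, by omega⟩ : ℕ) = (π ⟨d - 1, by omega⟩ : ℕ) + 1) ∨
    ((π ⟨j + 1, hj⟩ : ℕ) = 0 ∧ (π ⟨0, by omega⟩ : ℕ) = (π ⟨j, by omega⟩ : ℕ) + 1) ∨
    ((π ⟨j + 1, hj⟩ : ℕ) = (π ⟨d - 1, by omega⟩ : ℕ) + 1 ∧ (π ⟨j, by omega⟩ : ℕ) = d - 1)

/-- The Keane condition (idoc): the forward orbits of the interior discontinuities
`δ_i = leftEnd L i` (`i ≠ 0`) are pairwise disjoint infinite sets. -/
def KeaneCondition {d : ℕ} (π : Equiv.Perm (Fin d)) (L : Fin d → ℝ) : Prop :=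
  ∀ i j : Fin d, (i : ℕ) ≠ 0 → (j : ℕ) ≠ 0 → ∀ m n : ℕ,
    (ietMap π L)^[m] (leftEnd L i) = (ietMap π L)^[n] (leftEnd L j) → i = j ∧ m = n

/-- `w` is an allowed block for `T_{L,π}`: some point `x` satisfies
`T^{i+1} x ∈ I_{w i}` for all positions `i` of `w` (i.e. `x ∈ ⋂ T^{-i} I_{a_i}`). -/
def IsAllowedBlock {d : ℕ} (π : Equiv.Perm (Fin d)) (L : Fin d → ℝ)
    (w : List (Fin d)) : Prop :=
  ∃ x : ℝ, ∀ (i : ℕ) (hi : i < w.length),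
    (ietMap π L)^[i + 1] x ∈
      Set.Ico (leftEnd L (w.get ⟨i, hi⟩)) (leftEnd L (w.get ⟨i, hi⟩) + L (w.get ⟨i, hi⟩))

/-- `k`-alphabet mixing: there is `N` such that for any two allowed `k`-blocks `u, v`
and any `n > N` there is an allowed `n`-block beginning with `u` and ending with `v`. -/
def AlphabetMixing {d : ℕ} (π : Equiv.Perm (Fin d)) (L : Fin d → ℝ) (k : ℕ) : Prop :=
  ∃ N : ℕ, ∀ u v : List (Fin d), u.length = k → v.length = k →
    IsAllowedBlock π L u → IsAllowedBlock π L v →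
    ∀ n : ℕ, N < n → ∃ w : List (Fin d),
      w.length = n ∧ IsAllowedBlock π L w ∧ u <+: w ∧ v <:+ w

/-- `π'` is obtained from `π` by the Rauzy move of type `a`. -/
def RauzyMoveA {d : ℕ} [NeZero d] (π π' : Equiv.Perm (Fin d)) : Prop :=
  ∀ j : Fin d,
    ((j : ℕ) ≤ (π.symm (lastIdx d) : ℕ) → π' j = π j) ∧
    ((j : ℕ) = (π.symm (lastIdx d) : ℕ) + 1 → π' j = π (lastIdx d)) ∧
    ((π.symm (lastIdx d) : ℕ) + 1 < (j : ℕ) →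
      π' j = π ⟨(j : ℕ) - 1, lt_of_le_of_lt (Nat.sub_le _ _) j.isLt⟩)

/-- `π'` is obtained from `π` by the Rauzy move of type `b`. -/
def RauzyMoveB {d : ℕ} [NeZero d] (π π' : Equiv.Perm (Fin d)) : Prop :=
  ∀ j : Fin d,
    ((π j : ℕ) ≤ (π (lastIdx d) : ℕ) → π' j = π j) ∧
    ((π (lastIdx d) : ℕ) < (π j : ℕ) → (π j : ℕ) < d - 1 →
      (π' j : ℕ) = (π j : ℕ) + 1) ∧
    ((π j : ℕ) = d - 1 → (π' j : ℕ) = (π (lastIdx d) : ℕ) + 1)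

/-- `π` is in the Rauzy class of `π₀`: reachable by finitely many moves `a`, `b`. -/
def InRauzyClass {d : ℕ} [NeZero d] (π₀ π : Equiv.Perm (Fin d)) : Prop :=
  Relation.ReflTransGen (fun p q => RauzyMoveA p q ∨ RauzyMoveB p q) π₀ π

/-- The permutation `(4321)` on `{1,2,3,4}` (0-indexed: `j ↦ 3 - j`). -/
def perm4321 : Equiv.Perm (Fin 4) := ⟨![3, 2, 1, 0], ![3, 2, 1, 0], by decide, by decide⟩

/-- The permutation `(4213)` on `{1,2,3,4}`: `1↦4, 2↦2, 3↦1, 4↦3`. -/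
def perm4213 : Equiv.Perm (Fin 4) := ⟨![3, 1, 0, 2], ![2, 1, 3, 0], by decide, by decide⟩

/-- The combinatorial data of an interval exchange transformation:
a permutation together with a length vector. -/
structure IET (d : ℕ) where
  perm : Equiv.Perm (Fin d)
  len : Fin d → ℝ

/-- The first step of Rauzy induction on `T` is of type `a`, i.e.
`δ_max = δ_+` (equivalently `l_d < l_{π⁻¹ d}`). -/
def stepA {d : ℕ} [NeZero d] (T : IET d) : Prop :=
  T.len (lastIdx d) < T.len (T.perm.symm (lastIdx d))

/-- The first step of Rauzy induction on `T` is of type `b`, i.e.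
`δ_max = δ_-` (equivalently `l_{π⁻¹ d} < l_d`). -/
def stepB {d : ℕ} [NeZero d] (T : IET d) : Prop :=
  T.len (T.perm.symm (lastIdx d)) < T.len (lastIdx d)

/-- The length vector of `R(T)` after a type `a` step (the first return map of `T`
to `[0, δ_+)`, with intervals in their natural order). -/
noncomputable def lenAfterA {d : ℕ} [NeZero d] (π : Equiv.Perm (Fin d))
    (L : Fin d → ℝ) : Fin d → ℝ := fun j =>
  if (j : ℕ) < (π.symm (lastIdx d) : ℕ) then L j
  else if (j : ℕ) = (π.symm (lastIdx d) : ℕ) then L j - L (lastIdx d)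
  else if (j : ℕ) = (π.symm (lastIdx d) : ℕ) + 1 then L (lastIdx d)
  else L ⟨(j : ℕ) - 1, lt_of_le_of_lt (Nat.sub_le _ _) j.isLt⟩

/-- The length vector of `R(T)` after a type `b` step (the first return map of `T`
to `[0, δ_-)`). -/
noncomputable def lenAfterB {d : ℕ} [NeZero d] (π : Equiv.Perm (Fin d))
    (L : Fin d → ℝ) : Fin d → ℝ := fun j =>
  if j = lastIdx d then L j - L (π.symm (lastIdx d)) else L j

/-- `T'` is the result of one step of Rauzy induction applied to `T`
(`T' = R(T)`, un-rescaled). -/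
def IsRauzyStep {d : ℕ} [NeZero d] (T T' : IET d) : Prop :=
  (stepA T ∧ RauzyMoveA T.perm T'.perm ∧ T'.len = lenAfterA T.perm T.len) ∨
  (stepB T ∧ RauzyMoveB T.perm T'.perm ∧ T'.len = lenAfterB T.perm T.len)

/-- The matrix `M(T,1)` of a type `a` step. -/
def matA {d : ℕ} [NeZero d] (π : Equiv.Perm (Fin d)) : Matrix (Fin d) (Fin d) ℤ :=
  Matrix.of fun i j =>
    if (j : ℕ) ≤ (π.symm (lastIdx d) : ℕ) then (if i = j then 1 else 0)
    else if i = lastIdx d then (if (j : ℕ) = (π.symm (lastIdx d) : ℕ) + 1 then 1 else 0)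
    else if (i : ℕ) = (j : ℕ) - 1 then 1 else 0

/-- The matrix `M(T,1)` of a type `b` step. -/
def matB {d : ℕ} [NeZero d] (π : Equiv.Perm (Fin d)) : Matrix (Fin d) (Fin d) ℤ :=
  Matrix.of fun i j =>
    if i = lastIdx d ∧ j = π.symm (lastIdx d) then 1 else if i = j then 1 else 0

open Classical in
/-- The matrix `M(T,1)` of the first step of Rauzy induction on `T`. -/
noncomputable def stepMat {d : ℕ} [NeZero d] (T : IET d) : Matrix (Fin d) (Fin d) ℤ :=
  if stepA T then matA T.perm else matB T.perm

/-- A run of `n` steps of Rauzy induction: `seq 0 = T`, `seq (i+1) = R(seq i)`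
for `i < n`.  `T` admits `n` steps of Rauzy induction iff such a chain starting
at `T` exists. -/
structure RauzyChain (d : ℕ) [NeZero d] (n : ℕ) where
  seq : ℕ → IET d
  step : ∀ i, i < n → IsRauzyStep (seq i) (seq (i + 1))

/-- The matrix `M(R^a(T), m)` of the steps `a, a+1, …, a+m-1` of a chain. -/
noncomputable def chainMatrixFrom {d n : ℕ} [NeZero d] (c : RauzyChain d n)
    (a m : ℕ) : Matrix (Fin d) (Fin d) ℤ :=
  ((List.range m).map fun i => stepMat (c.seq (a + i))).prod

/-- The matrix `M(T, m)` of the first `m` steps of a chain starting at `T`. -/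
noncomputable def chainMatrix {d n : ℕ} [NeZero d] (c : RauzyChain d n)
    (m : ℕ) : Matrix (Fin d) (Fin d) ℤ :=
  chainMatrixFrom c 0 m

/-- `|C_j(M)|`, the sum of the entries of the `j`-th column of `M`. -/
def colSum {d : ℕ} (M : Matrix (Fin d) (Fin d) ℤ) (j : Fin d) : ℤ := ∑ i, M i j

/-- `M_Δ = M ℝ₊^d ∩ Δ̊_{d-1}`: positive vectors of the cone of `M` lying in the
interior of the standard simplex. -/
def matSimplex {d : ℕ} (M : Matrix (Fin d) (Fin d) ℤ) : Set (Fin d → ℝ) :=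
  {L | (∃ v : Fin d → ℝ, (∀ i, 0 ≤ v i) ∧ L = (M.map (Int.cast : ℤ → ℝ)).mulVec v) ∧
       (∀ i, 0 < L i) ∧ ∑ i, L i = 1}

/-- `u^n`, the `n`-fold concatenation of the word `u` with itself. -/
def wpow {α : Type*} (u : List α) (n : ℕ) : List α := (List.replicate n u).flatten

theorem wpow_add {α : Type*} (u : List α) (m n : ℕ) :
    wpow u (m + n) = wpow u m ++ wpow u n := by
  simp only [wpow, List.replicate_add, List.flatten_append]

theorem wpow_one {α : Type*} (u : List α) : wpow u 1 = u := by
  simp [wpow]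

theorem length_wpow {α : Type*} (u : List α) (n : ℕ) :
    (wpow u n).length = n * u.length := by
  simp [wpow]

/-- Every integer interval of length `b` contains a solution `i` of `a * i ≡ n` modulo `b`,
for `a` coprime to `b`. -/
theorem exists_dvd_sub_mul_of_isCoprime {a b : ℤ} (hab : IsCoprime a b) (hb : 0 < b)
    (n l : ℤ) : ∃ i, l ≤ i ∧ i < l + b ∧ b ∣ n - a * i := by
  obtain ⟨u, v, huv⟩ := hab
  have hnonneg := Int.emod_nonneg (n * u - l) hb.ne'
  have hlt := Int.emod_lt_of_pos (n * u - l) hb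
  refine ⟨l + (n * u - l) % b, by linarith, by linarith, n * v + a * ((n * u - l) / b), ?_⟩
  have hdiv := Int.emod_add_mul_ediv (n * u - l) b
  linear_combination (-n) * huv - a * hdiv

/-- Representation of `n` as `i * a + j * b` with both coefficients positive and bounded
by `K`. -/
theorem exists_bounded_mul_add_mul_eq {a b K n : ℤ} (ha : 0 < a) (hb : 0 < b)
    (hab : IsCoprime a b) (hbK : b ≤ K) (haK : a ≤ K) (hn : a * b < n)
    (hn' : n + a * b ≤ K * a + K * b) :
    ∃ i j, 1 ≤ i ∧ i ≤ K ∧ 1 ≤ j ∧ j ≤ K ∧ i * a + j * b = n := by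
  obtain ⟨l, hl, hlK, hl'⟩ : ∃ l, 1 ≤ l ∧ n - K * b ≤ a * l ∧
      (l = 1 ∨ a * (l - 1) < n - K * b) := by
    rcases le_or_gt (n - K * b) a with h | h
    · exact ⟨1, le_rfl, by linarith, Or.inl rfl⟩
    · have hdiv := Int.emod_add_mul_ediv (n - K * b - 1) a
      have hnonneg := Int.emod_nonneg (n - K * b - 1) ha.ne'
      have hlt := Int.emod_lt_of_pos (n - K * b - 1) ha
      have hq : 0 ≤ (n - K * b - 1) / a := Int.ediv_nonneg (by linarith) ha.le
      refine ⟨(n - K * b - 1) / a + 1, by linarith, by linarith, Or.inr ?_⟩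
      rw [add_sub_cancel_right]
      linarith
  obtain ⟨i, hi, hib, j, hj⟩ := exists_dvd_sub_mul_of_isCoprime hab hb n l
  have hal : a * l ≤ a * i := mul_le_mul_of_nonneg_left hi ha.le
  have hai : a * i ≤ a * (l - 1) + a * b := by
    rw [← mul_add]
    exact mul_le_mul_of_nonneg_left (by linarith) ha.le
  have habK : a * b ≤ K * b := mul_le_mul_of_nonneg_right haK hb.le
  refine ⟨i, j, by linarith, ?_, ?_, ?_, by linarith⟩
  · rcases hl' with rfl | hl'
    · linarith
    · refine le_of_mul_le_mul_left (a := a) ?_ ha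
      linarith
  · have hpos : 0 < b * j := by
      rcases hl' with rfl | hl' <;> linarith
    have := pos_of_mul_pos_right hpos hb.le
    linarith
  · refine le_of_mul_le_mul_left (a := b) ?_ hb
    linarith

theorem wpow_append_wpow_isInfix {α : Type*} (u v W : List α) {i j m n : ℕ}
    (hi : i ≤ m) (hj : j ≤ n) :
    wpow u i ++ W ++ wpow v j <:+: wpow u m ++ W ++ wpow v n := by
  obtain ⟨k, rfl⟩ := Nat.exists_eq_add_of_le' hi
  obtain ⟨l, rfl⟩ := Nat.exists_eq_add_of_le hj
  exact ⟨wpow u k, wpow v l, by simp [wpow_add]⟩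

/-- With `gcd(|B₂|,|B₃|) = 1`, `g = 2|B₂||B₃|`, for every
`|W| + g ≤ r ≤ |W| + 5g|B₂| + 5g|B₃| - g` the word `B₂^{5g} W B₃^{5g}` has a factor
`w` of length `r` of the form `w = B₂ m B₃`. -/
theorem factor_of_prescribed_length {α : Type*} (B₂ B₃ : List α)
    (h2 : B₂ ≠ []) (h3 : B₃ ≠ [])
    (hgcd : Nat.gcd B₂.length B₃.length = 1)
    (g : ℕ) (hg : g = 2 * B₂.length * B₃.length)
    (W : List α) (r : ℕ) (hr1 : W.length + g ≤ r)
    (hr2 : (r : ℤ) ≤ (W.length : ℤ) + 5 * g * B₂.length + 5 * g * B₃.length - g) :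
    ∃ w m : List α, w.length = r ∧ w = B₂ ++ m ++ B₃ ∧
      w <:+: (wpow B₂ (5 * g) ++ W ++ wpow B₃ (5 * g)) := by
  have ha : 0 < B₂.length := List.length_pos_iff.mpr h2
  have hb : 0 < B₃.length := List.length_pos_iff.mpr h3
  have hab : 0 < B₂.length * B₃.length := Nat.mul_pos ha hb
  have haab : B₂.length ≤ B₂.length * B₃.length := Nat.le_mul_of_pos_right _ hb
  have hbab : B₃.length ≤ B₂.length * B₃.length := Nat.le_mul_of_pos_left _ ha
  rw [mul_assoc] at hg
  obtain ⟨i, j, hi, hiK, hj, hjK, hij⟩ :=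
    exists_bounded_mul_add_mul_eq (a := B₂.length) (b := B₃.length) (K := 5 * g)
      (n := r - W.length) (by exact_mod_cast ha) (by exact_mod_cast hb)
      (Nat.isCoprime_iff_coprime.mpr hgcd) (by omega) (by omega)
      (by rw [← Nat.cast_mul]; omega) (by rw [← Nat.cast_mul]; omega)
  lift i to ℕ using by omega
  lift j to ℕ using by omega
  obtain ⟨i, rfl⟩ := Nat.exists_eq_add_of_le (show 1 ≤ i by omega)
  obtain ⟨j, rfl⟩ := Nat.exists_eq_add_of_le' (show 1 ≤ j by omega)
  refine ⟨wpow B₂ (1 + i) ++ W ++ wpow B₃ (j + 1), wpow B₂ i ++ W ++ wpow B₃ j, ?_, ?_,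
    wpow_append_wpow_isInfix _ _ _ (by omega) (by omega)⟩
  · simp only [List.length_append, length_wpow]
    zify
    push_cast at hij
    linarith
  · simp [wpow_add, wpow_one]

end IETPaper
end

section
/- Let B_2 and B_3 be nonempty finite words over an alphabet with gcd(|B_2|, |B_3|) = 1, set g = 2|B_2||B_3|, let W be any finite word, let u be a factor of B_3 and let v be a factor of B_2. Then for every natural number r with |W| + g + |B_2| + |B_3| ≤ r ≤ |W| + 5g|B_2| + 5g|B_3| − g − |B_2| − |B_3|, the word B_3^{5g} * W * B_2^{5g} has a factor w with |w| = r of the form w = u * m * v for some (possibly empty) word m. -/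
open Finset MeasureTheory

namespace IETPaper

/-- Two coprime weights represent every number that is at least `2 * a * b` away from both ends
of the range of `i * a + j * b` for `i, j ≤ N`. -/
theorem exists_bounded_mul_add_mul {a b N R : ℕ} (ha : 0 < a)
    (hab : Nat.gcd a b = 1) (haN : a ≤ N) (hbN : b ≤ N) (hR : 2 * a * b ≤ R)
    (hR' : R + 2 * a * b ≤ N * (a + b)) :
    ∃ i j : ℕ, i ≤ N ∧ j ≤ N ∧ i * a + j * b = R := by
  classical
  obtain ⟨i₀, j₀, h₀⟩ : ∃ i j : ℕ, i * a + j * b = R := by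
    refine Nat.exists_add_mul_eq_of_gcd_dvd_of_mul_pred_le a b R (by simp [hab]) ?_
    calc a.pred * b.pred ≤ a * b := Nat.mul_le_mul (Nat.pred_le a) (Nat.pred_le b)
      _ ≤ R := by nlinarith
  let P : ℕ → Prop := fun j => ∃ i, i * a + j * b = R
  have hP : P (j₀ % a) := by
    refine ⟨i₀ + b * (j₀ / a), ?_⟩
    conv_rhs => rw [← h₀, ← Nat.mod_add_div j₀ a]
    ring
  have hle : Nat.findGreatest P N ≤ N := Nat.findGreatest_le N
  have hspec : P (Nat.findGreatest P N) :=
    Nat.findGreatest_spec ((Nat.mod_lt j₀ ha).le.trans haN) hP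
  have hmax : ∀ k, k ≤ N → P k → k ≤ Nat.findGreatest P N := fun k => Nat.le_findGreatest
  generalize Nat.findGreatest P N = j at hle hspec hmax
  obtain ⟨i, hi⟩ := hspec
  refine ⟨i, j, ?_, hle, hi⟩
  by_cases hj : j + a ≤ N
  · by_contra! hiN
    obtain ⟨c, rfl⟩ := Nat.exists_eq_add_of_le (hbN.trans hiN.le)
    have := hmax (j + a) hj ⟨c, by rw [← hi]; ring⟩
    omega
  · refine Nat.le_of_mul_le_mul_right ?_ ha
    nlinarith [Nat.mul_le_mul_right b (not_le.mp hj).le]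

/-- With `gcd(|B₂|,|B₃|) = 1`, `g = 2|B₂||B₃|`, `u` a factor of `B₃`
and `v` a factor of `B₂`, for every
`|W| + g + |B₂| + |B₃| ≤ r ≤ |W| + 5g|B₂| + 5g|B₃| - g - |B₂| - |B₃|` the word
`B₃^{5g} W B₂^{5g}` has a factor `w` of length `r` of the form `w = u m v`. -/
theorem factor_u_m_v' {α : Type*} (B₂ B₃ : List α)
    (h2 : B₂ ≠ []) (h3 : B₃ ≠ [])
    (hgcd : Nat.gcd B₂.length B₃.length = 1)
    (g : ℕ) (hg : g = 2 * B₂.length * B₃.length)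
    (W : List α) (u v : List α) (hu : u <:+: B₃) (hv : v <:+: B₂)
    (r : ℕ) (hr1 : W.length + g + B₂.length + B₃.length ≤ r)
    (hr2 : (r : ℤ) ≤ (W.length : ℤ) + 5 * g * B₂.length + 5 * g * B₃.length
      - g - B₂.length - B₃.length) :
    ∃ w m : List α, w.length = r ∧ w = u ++ m ++ v ∧
      w <:+: (wpow B₃ (5 * g) ++ W ++ wpow B₂ (5 * g)) := by
  obtain ⟨p, s, rfl⟩ := hu
  obtain ⟨p', s', rfl⟩ := hv
  have ha := List.length_pos_of_ne_nil h3
  have hb := List.length_pos_of_ne_nil h2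
  have hlb : (p' ++ v ++ s').length = p'.length + v.length + s'.length := by simp; omega
  have hla : (p ++ u ++ s).length = p.length + u.length + s.length := by simp; omega
  generalize hB₃ : p ++ u ++ s = B₃ at *
  generalize hB₂ : p' ++ v ++ s' = B₂ at *
  have hg' : g = 2 * B₃.length * B₂.length := by rw [hg]; ring
  have hga : B₃.length ≤ g := by nlinarith
  have hgb : B₂.length ≤ g := by nlinarith
  have hr2' : r + g + B₂.length + B₃.length ≤
      W.length + 5 * g * B₂.length + 5 * g * B₃.length := by
    zify; linarith
  obtain ⟨N, hN⟩ : ∃ N, 5 * g = N + 1 := ⟨5 * g - 1, by omega⟩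
  obtain ⟨R, hR⟩ := Nat.exists_eq_add_of_le
    (show W.length + (u.length + s.length) + (p'.length + v.length) ≤ r by omega)
  obtain ⟨i, j, hi, hj, hij⟩ := exists_bounded_mul_add_mul (N := N) (R := R) ha
    (by rwa [Nat.gcd_comm]) (by omega) (by omega) (by omega) (by
      rw [hN] at hr2'
      rw [← hg']
      nlinarith)
  obtain ⟨k, rfl⟩ := Nat.exists_eq_add_of_le' hi
  obtain ⟨l, hl⟩ := Nat.exists_eq_add_of_le hj
  have e₃ : wpow B₃ (5 * g) = wpow B₃ k ++ (p ++ u ++ s) ++ wpow B₃ i := by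
    rw [hB₃, hN, add_right_comm, wpow_add, wpow_add, wpow_one]
  have e₂ : wpow B₂ (5 * g) = wpow B₂ j ++ (p' ++ v ++ s') ++ wpow B₂ l := by
    rw [hB₂, hN, hl, add_right_comm, wpow_add, wpow_add, wpow_one]
  refine ⟨_, s ++ wpow B₃ i ++ W ++ wpow B₂ j ++ p', ?_, rfl,
    wpow B₃ k ++ p, s' ++ wpow B₂ l, ?_⟩
  · simp only [List.length_append, length_wpow]
    omega
  · rw [e₃, e₂]
    simp only [List.append_assoc]

end IETPaper
end

section
/- Let B_2 and B_3 be nonempty finite words over an alphabet with gcd(|B_2|, |B_3|) = 1 and set g = 2|B_2||B_3|. Let B_4, P, S and W be arbitrary finite words, let u be a factor of B_3 and let v be a factor of B_2, and set Z = P * B_3^{5g} * B_4 * W * B_2^{5g+1} * S. Then for every natural number r with |W| + |B_4| + g + |B_2| + |B_3| ≤ r ≤ |W| + 5g|B_2| + 5g|B_3| − |B_2| − |B_3| − g, the word Z has a factor w with |w| = r of the form w = u * m * v for some (possibly empty) word m. -/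
open Finset MeasureTheory

namespace IETPaper

/-- A single copy of `u` inside `u^n`, with `j` copies after it. -/
theorem wpow_eq_append_self_append {α : Type*} (u : List α) {n j : ℕ} (h : j < n) :
    wpow u n = wpow u (n - j - 1) ++ u ++ wpow u j := by
  have hn : n = (n - j - 1) + 1 + j := by omega
  have h1 : wpow u 1 = u := by simp [wpow]
  conv_lhs => rw [hn, wpow_add, wpow_add, h1]

/-- Every interval of `a` consecutive integers contains a solution `j` of
`j * b ≡ N (mod a)` when `a` and `b` are coprime. -/
theorem exists_mul_modEq_of_coprime {a b : ℤ} (ha : 0 < a) (h : IsCoprime a b)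
    (N lo : ℤ) : ∃ j, lo ≤ j ∧ j < lo + a ∧ a ∣ N - j * b := by
  obtain ⟨s, t, hst⟩ := h
  refine ⟨lo + (N * t - lo) % a, ?_, ?_, N * s + (N * t - lo) / a * b, ?_⟩
  · have := Int.emod_nonneg (N * t - lo) ha.ne'
    omega
  · have := Int.emod_lt_of_pos (N * t - lo) ha
    omega
  · linear_combination (-N) * hst - b * Int.emod_add_mul_ediv (N * t - lo) a

/-- A version of the coin problem for two coprime denominations with bounded multiplicities. -/
theorem exists_bounded_mul_add_mul_s11 {a b : ℕ} (ha : 0 < a) (hb : 0 < b)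
    (hab : Nat.Coprime a b) {J K N : ℕ} (hJ : a ≤ J) (hK : b ≤ K) (hN : a * b ≤ N)
    (hN' : N + a * b ≤ J * b + K * a) :
    ∃ j k : ℕ, j ≤ J ∧ k ≤ K ∧ j * b + k * a = N := by
  have ha' : (0 : ℤ) < a := by exact_mod_cast ha
  have hb' : (0 : ℤ) < b := by exact_mod_cast hb
  zify at hJ hK hN hN'
  obtain ⟨j, hj0, hjJ, hjN, hNj, q, hq⟩ : ∃ j : ℤ, 0 ≤ j ∧ j ≤ J ∧ j * b ≤ N ∧
      N ≤ j * b + K * a ∧ (a : ℤ) ∣ N - j * b := by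
    rcases le_total (N : ℤ) (K * a) with hc | hc
    · obtain ⟨j, h1, h2, h3⟩ :=
        exists_mul_modEq_of_coprime ha' (Nat.isCoprime_iff_coprime.2 hab) N 0
      exact ⟨j, h1, by linarith, by nlinarith, by nlinarith, h3⟩
    · set lo : ℤ := (N - K * a + b - 1) / b with hlo
      have e1 := Int.emod_add_mul_ediv ((N : ℤ) - K * a + b - 1) b
      have e2 := Int.emod_nonneg ((N : ℤ) - K * a + b - 1) hb'.ne'
      have e3 := Int.emod_lt_of_pos ((N : ℤ) - K * a + b - 1) hb'
      rw [← hlo] at e1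
      have hlo0 : 0 ≤ lo := Int.ediv_nonneg (by linarith) hb'.le
      obtain ⟨j, h1, h2, h3⟩ :=
        exists_mul_modEq_of_coprime ha' (Nat.isCoprime_iff_coprime.2 hab) N lo
      have h4 : lo * b ≤ j * b := mul_le_mul_of_nonneg_right h1 hb'.le
      have h5 : j * b ≤ (lo + a - 1) * b := mul_le_mul_of_nonneg_right (by linarith) hb'.le
      have h6 : (b : ℤ) * a ≤ K * a := mul_le_mul_of_nonneg_right hK ha'.le
      exact ⟨j, by linarith, le_of_mul_le_mul_right (by linarith) hb', by linarith,
        by linarith, h3⟩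
  have hq0 : 0 ≤ q := nonneg_of_mul_nonneg_right (by linarith) ha'
  have hqK : q ≤ K := le_of_mul_le_mul_right (by linarith) ha'
  lift j to ℕ using hj0
  lift q to ℕ using hq0
  refine ⟨j, q, by exact_mod_cast hjJ, by exact_mod_cast hqK, ?_⟩
  zify
  linarith

/-- With `gcd(|B₂|,|B₃|) = 1`, `g = 2|B₂||B₃|`, `u` a factor of `B₃`,
`v` a factor of `B₂`, and `Z = P B₃^{5g} B₄ W B₂^{5g+1} S`, for every
`|W| + |B₄| + g + |B₂| + |B₃| ≤ r ≤ |W| + 5g|B₂| + 5g|B₃| - |B₂| - |B₃| - g` the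
word `Z` has a factor `w` of length `r` of the form `w = u m v`. -/
theorem factor_across_blocks {α : Type*} (B₂ B₃ : List α)
    (h2 : B₂ ≠ []) (h3 : B₃ ≠ [])
    (hgcd : Nat.gcd B₂.length B₃.length = 1)
    (g : ℕ) (hg : g = 2 * B₂.length * B₃.length)
    (B₄ P S W : List α) (u v : List α) (hu : u <:+: B₃) (hv : v <:+: B₂)
    (Z : List α)
    (hZ : Z = P ++ wpow B₃ (5 * g) ++ B₄ ++ W ++ wpow B₂ (5 * g + 1) ++ S)
    (r : ℕ) (hr1 : W.length + B₄.length + g + B₂.length + B₃.length ≤ r)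
    (hr2 : (r : ℤ) ≤ (W.length : ℤ) + 5 * g * B₂.length + 5 * g * B₃.length
      - B₂.length - B₃.length - g) :
    ∃ w m : List α, w.length = r ∧ w = u ++ m ++ v ∧ w <:+: Z := by
  obtain ⟨x, y, rfl⟩ := hu
  obtain ⟨z, t, rfl⟩ := hv
  set B₃ := x ++ u ++ y with hB₃
  set B₂ := z ++ v ++ t with hB₂
  have ha : 0 < B₂.length := List.length_pos_iff.2 h2
  have hb : 0 < B₃.length := List.length_pos_iff.2 h3
  have la : z.length + v.length + t.length = B₂.length := by simp [hB₂]; omega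
  have lb : x.length + u.length + y.length = B₃.length := by simp [hB₃]; omega
  have hga : B₂.length ≤ g := by nlinarith
  have hgb : B₃.length ≤ g := by nlinarith
  have hg2 : 2 * (B₂.length * B₃.length) = g := by rw [hg]; ring
  obtain ⟨N, hN⟩ : ∃ N, r = u.length + y.length + B₄.length + W.length + z.length + v.length + N :=
    Nat.exists_eq_add_of_le (by omega)
  have hJ : ((5 * g - 1 : ℕ) : ℤ) = 5 * g - 1 := by omega
  obtain ⟨j, k, hj, hk, hjk⟩ := exists_bounded_mul_add_mul_s11 (J := 5 * g - 1) (K := 5 * g) (N := N)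
    ha hb hgcd (by omega) (by omega) (by omega) (by
      zify at hN hg2 ⊢
      rw [hJ]
      have : (0 : ℤ) ≤ B₂.length * B₃.length := by positivity
      linarith)
  refine ⟨u ++ (y ++ wpow B₃ j ++ B₄ ++ W ++ wpow B₂ k ++ z) ++ v, _, ?_, rfl,
    P ++ wpow B₃ (5 * g - j - 1) ++ x, t ++ wpow B₂ (5 * g - k) ++ S, ?_⟩
  · simp only [List.length_append, length_wpow]
    omega
  · have e3 : wpow B₂ (5 * g + 1) = wpow B₂ k ++ B₂ ++ wpow B₂ (5 * g - k) := by
      rw [wpow_eq_append_self_append B₂ (j := 5 * g - k) (by omega)]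
      congr 3
      omega
    have e4 := wpow_eq_append_self_append B₃ (n := 5 * g) (j := j) (by omega)
    rw [hZ, e3, e4]
    generalize wpow B₃ j = q1, wpow B₃ (5 * g - j - 1) = q2, wpow B₂ k = q3,
      wpow B₂ (5 * g - k) = q4
    simp only [hB₂, hB₃, List.append_assoc]

end IETPaper
end

section
/- Let B_2 and B_3 be nonempty finite words over an alphabet with gcd(|B_2|, |B_3|) = 1 and set g = 2|B_2||B_3|. Let B_1, B_4, P, S and W' be arbitrary finite words, let u be a factor of B_2 and let v be a factor of B_3, and set Z = P * B_2^{5g} * B_3^{5g+1} * B_4 * W' * B_1 * B_3^{5g} * S. Then for every natural number r with |W'| + |B_4| + |B_1| + g + |B_2| + |B_3| + 5g|B_3| ≤ r ≤ |W'| + |B_4| − g − |B_2| − |B_3| + 5g|B_2| + 10g|B_3|, the word Z has a factor w with |w| = r of the form w = u * m * v for some (possibly empty) word m. -/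
open Finset MeasureTheory

namespace IETPaper

theorem wpow_split {α : Type*} (u : List α) {n i : ℕ} (hi : i < n) :
    wpow u n = wpow u (n - 1 - i) ++ (u ++ wpow u i) := by
  conv_lhs => rw [show n = (n - 1 - i) + (1 + i) by omega]
  rw [wpow_add, wpow_add, wpow_one]

theorem wpow_split' {α : Type*} (u : List α) {n i : ℕ} (hi : i < n) :
    wpow u n = wpow u i ++ (u ++ wpow u (n - 1 - i)) := by
  conv_lhs => rw [show n = i + (1 + (n - 1 - i)) by omega]
  rw [wpow_add, wpow_add, wpow_one]

/-- For coprime `p` and `q`, every integer `N` far enough from both ends of `[0, M p + M q]`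
is a combination of `p` and `q` with coefficients in `[0, M]`. -/
theorem exists_bounded_combination {p q M N : ℕ} (hp : 0 < p) (hq : 0 < q)
    (hpq : Nat.gcd p q = 1) (hpM : p ≤ M) (hqM : q ≤ M) (hN : p * q ≤ N)
    (hN' : N + p * q ≤ M * p + M * q) :
    ∃ i j : ℕ, i ≤ M ∧ j ≤ M ∧ i * p + j * q = N := by
  obtain ⟨lo, hlo, hlo'⟩ : ∃ lo : ℤ,
      max 0 ((N : ℤ) - M * q) ≤ lo * p ∧ lo * p < max 0 ((N : ℤ) - M * q) + p := by
    have hp' : (0 : ℤ) < p := by exact_mod_cast hp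
    refine ⟨-(-(max 0 ((N : ℤ) - M * q)) / p), ?_, ?_⟩
    · linarith [Int.ediv_mul_le (-(max 0 ((N : ℤ) - M * q))) hp'.ne']
    · linarith [Int.lt_ediv_add_one_mul_self (-(max 0 ((N : ℤ) - M * q))) hp']
  have hp' : (0 : ℤ) < p := by exact_mod_cast hp
  have hq' : (0 : ℤ) < q := by exact_mod_cast hq
  have hpM' : (p : ℤ) ≤ M := by exact_mod_cast hpM
  have hqM' : (q : ℤ) ≤ M := by exact_mod_cast hqM
  have hNz : (p : ℤ) * q ≤ N := by exact_mod_cast hN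
  have hNz' : (N : ℤ) + p * q ≤ M * p + M * q := by exact_mod_cast hN'
  have hbez : (1 : ℤ) = p * Nat.gcdA p q + q * Nat.gcdB p q := by
    rw [← Nat.gcd_eq_gcd_ab, hpq, Nat.cast_one]
  set a := Nat.gcdA p q
  set b := Nat.gcdB p q
  set k := (N * a - lo) / (q : ℤ)
  set t := (N * a - lo) % (q : ℤ)
  have hkt : t + q * k = N * a - lo := Int.emod_add_mul_ediv _ _
  have ht0 : 0 ≤ t := Int.emod_nonneg _ hq'.ne'
  have htq : t + 1 ≤ q := Int.emod_lt_of_pos _ hq'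
  have hsum : (lo + t) * p + (N * b + k * p) * q = N := by
    linear_combination (p : ℤ) * hkt - (N : ℤ) * hbez
  have hmul : (t + 1) * p ≤ q * p := mul_le_mul_of_nonneg_right htq hp'.le
  have htp : 0 ≤ t * p := mul_nonneg ht0 hp'.le
  have hMq : (p : ℤ) * q ≤ M * q := mul_le_mul_of_nonneg_right hpM' hq'.le
  have hMp : (q : ℤ) * p ≤ M * p := mul_le_mul_of_nonneg_right hqM' hp'.le
  have hmax : max 0 ((N : ℤ) - M * q) + q * p ≤ min (N : ℤ) (M * p) := by
    rcases max_cases 0 ((N : ℤ) - M * q) with ⟨h, -⟩ | ⟨h, -⟩ <;> rw [h] <;>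
      exact le_min (by linarith) (by linarith)
  have hi0 : 0 ≤ lo + t := nonneg_of_mul_nonneg_left
    (by linarith [le_max_left 0 ((N : ℤ) - M * q)] : 0 ≤ (lo + t) * p) hp'
  have hiM : lo + t ≤ M := le_of_mul_le_mul_right
    (by linarith [min_le_right (N : ℤ) (M * p)]) hp'
  have hj0 : 0 ≤ N * b + k * p := nonneg_of_mul_nonneg_left
    (by linarith [min_le_left (N : ℤ) (M * p)] : 0 ≤ (N * b + k * p) * q) hq'
  have hjM : N * b + k * p ≤ M := le_of_mul_le_mul_right
    (by linarith [le_max_right 0 ((N : ℤ) - M * q)]) hq'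
  lift lo + t to ℕ using hi0 with i
  lift N * b + k * p to ℕ using hj0 with j
  exact ⟨i, j, by exact_mod_cast hiM, by exact_mod_cast hjM, by exact_mod_cast hsum⟩

/-- With `gcd(|B₂|,|B₃|) = 1`, `g = 2|B₂||B₃|`, `u` a factor of `B₂`,
`v` a factor of `B₃`, and `Z = P B₂^{5g} B₃^{5g+1} B₄ W' B₁ B₃^{5g} S`, for every
`r` with `|W'| + |B₄| + |B₁| + g + |B₂| + |B₃| + 5g|B₃| ≤ r` and
`r ≤ |W'| + |B₄| - g - |B₂| - |B₃| + 5g|B₂| + 10g|B₃|`, the word `Z` has a factor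
`w` of length `r` of the form `w = u m v`. -/
theorem factor_across_blocks' {α : Type*} (B₂ B₃ : List α)
    (h2 : B₂ ≠ []) (h3 : B₃ ≠ [])
    (hgcd : Nat.gcd B₂.length B₃.length = 1)
    (g : ℕ) (hg : g = 2 * B₂.length * B₃.length)
    (B₁ B₄ P S W' : List α) (u v : List α) (hu : u <:+: B₂) (hv : v <:+: B₃)
    (Z : List α)
    (hZ : Z = P ++ wpow B₂ (5 * g) ++ wpow B₃ (5 * g + 1) ++ B₄ ++ W' ++ B₁ ++
      wpow B₃ (5 * g) ++ S)
    (r : ℕ)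
    (hr1 : W'.length + B₄.length + B₁.length + g + B₂.length + B₃.length
      + 5 * g * B₃.length ≤ r)
    (hr2 : (r : ℤ) ≤ (W'.length : ℤ) + B₄.length - g - B₂.length - B₃.length
      + 5 * g * B₂.length + 10 * g * B₃.length) :
    ∃ w m : List α, w.length = r ∧ w = u ++ m ++ v ∧ w <:+: Z := by
  obtain ⟨s₂, t₂, rfl⟩ := hu
  obtain ⟨s₃, t₃, rfl⟩ := hv
  have hp := List.length_pos_iff.mpr h2
  have hq := List.length_pos_iff.mpr h3
  have hp_len : (s₂ ++ u ++ t₂).length = s₂.length + u.length + t₂.length := by simp [add_assoc]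
  have hq_len : (s₃ ++ v ++ t₃).length = s₃.length + v.length + t₃.length := by simp [add_assoc]
  set B₂ := s₂ ++ u ++ t₂ with hB₂
  set B₃ := s₃ ++ v ++ t₃ with hB₃
  set p := B₂.length
  set q := B₃.length
  have hpg : 2 * p ≤ g := by nlinarith
  have hqg : 2 * q ≤ g := by nlinarith
  have hqpq : q ≤ p * q := by nlinarith
  have hg' : g = 2 * (p * q) := by rw [hg, mul_assoc]
  have hr2' : r + g + p + q ≤ W'.length + B₄.length + 5 * g * p + 10 * g * q := by
    zify; linarith
  have hM : ∀ x, (5 * g - 1) * x + x = 5 * g * x := fun x => by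
    rw [← Nat.succ_mul]; congr 1; omega
  have hMp := hM p
  have hMq := hM q
  have h10 : 10 * g * q = 2 * (5 * g * q) := by ring
  obtain ⟨N, hN⟩ : ∃ N, r = N + (u.length + t₂.length + (5 * g * q + q) + B₄.length + W'.length
      + B₁.length + s₃.length + v.length) := Nat.exists_eq_add_of_le' (by omega)
  obtain ⟨i, j, hi, hj, hij⟩ := exists_bounded_combination (M := 5 * g - 1) (N := N) hp hq hgcd
    (by omega) (by omega) (by omega) (by omega)
  refine ⟨_, t₂ ++ wpow B₂ i ++ wpow B₃ (5 * g + 1) ++ B₄ ++ W' ++ B₁ ++ wpow B₃ j ++ s₃,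
    ?_, rfl, P ++ wpow B₂ (5 * g - 1 - i) ++ s₂, t₃ ++ wpow B₃ (5 * g - 1 - j) ++ S, ?_⟩
  · have h1 : (5 * g + 1) * q = 5 * g * q + q := by ring
    simp only [List.length_append, length_wpow]
    change _ + (_ + i * p + (5 * g + 1) * q + _ + _ + _ + j * q + _) + _ = _
    omega
  · rw [hZ, wpow_split B₂ (show i < 5 * g by omega), wpow_split' B₃ (show j < 5 * g by omega)]
    generalize wpow B₂ i = x, wpow B₂ (5 * g - 1 - i) = x', wpow B₃ (5 * g + 1) = y,
      wpow B₃ j = z, wpow B₃ (5 * g - 1 - j) = z'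
    simp only [hB₂, hB₃, List.append_assoc]

end IETPaper
end

section
/- Let T be an interval exchange transformation on d intervals admitting n + k steps of Rauzy induction, and suppose that the matrix M(R^n(T), k) has all entries positive. Fix i ∈ {1,…,d} and let L = C_i(M(T,n+k)) / |C_i(M(T,n+k))| be the normalized i-th column of M(T,n+k). Then the interval exchange transformation S with length vector L and permutation π(T) admits at least n steps of Rauzy induction and agrees with T through the first n steps of Rauzy induction: for each 1 ≤ m ≤ n, the m-th step of Rauzy induction of S has the same type (a or b) as that of T, and π(R^m(S)) = π(R^m(T)). -/
open Finset MeasureTheory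

namespace IETPaper

theorem lenAfterA_of_matA {d : ℕ} [NeZero d] {π : Equiv.Perm (Fin d)}
    (hp : π.symm (lastIdx d) ≠ lastIdx d) {v w : Fin d → ℝ} (hw : ∀ j, 0 < w j)
    (hv : ∀ r, v r = ∑ j, (matA π r j : ℝ) * w j) :
    (∀ r, 0 < v r) ∧ stepA ⟨π, v⟩ ∧ w = lenAfterA π v := by
  have hlast : ((lastIdx d : Fin d) : ℕ) = d - 1 := rfl
  set p := π.symm (lastIdx d) with hpdef
  have hplt : (p : ℕ) + 1 < d := by
    have := p.isLt
    have : (p : ℕ) ≠ d - 1 := fun h => hp (Fin.ext h)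
    omega
  have row_last : v (lastIdx d) = w ⟨p + 1, hplt⟩ := by
    have h : ∀ j, matA π (lastIdx d) j = if j = ⟨p + 1, hplt⟩ then 1 else 0 := by
      intro j
      simp only [matA, Matrix.of_apply, ← hpdef, Fin.ext_iff, hlast]
      split_ifs <;> first | rfl | omega
    simp [hv, h]
  have row_lt : ∀ r : Fin d, (r : ℕ) < p → v r = w r := by
    intro r hr
    have h : ∀ j, matA π r j = if j = r then 1 else 0 := by
      intro j
      simp only [matA, Matrix.of_apply, ← hpdef, Fin.ext_iff, hlast]
      split_ifs <;> first | rfl | omega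
    simp [hv, h]
  have row_eq : v p = w p + w ⟨p + 1, hplt⟩ := by
    have h : ∀ j, matA π p j =
        (if j = p then 1 else 0) + (if j = ⟨p + 1, hplt⟩ then 1 else 0) := by
      intro j
      simp only [matA, Matrix.of_apply, ← hpdef, Fin.ext_iff, hlast]
      split_ifs <;> first | rfl | omega
    simp [hv, h, add_mul, Finset.sum_add_distrib]
  have row_gt : ∀ (r : Fin d) (hr : (r : ℕ) + 1 < d), (p : ℕ) < r → v r = w ⟨r + 1, hr⟩ := by
    intro r hr hpr
    have h : ∀ j, matA π r j = if j = ⟨r + 1, hr⟩ then 1 else 0 := by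
      intro j
      simp only [matA, Matrix.of_apply, ← hpdef, Fin.ext_iff, hlast]
      split_ifs <;> first | rfl | omega
    simp [hv, h]
  refine ⟨fun r => ?_, ?_, ?_⟩
  · rcases lt_trichotomy (r : ℕ) p with h | h | h
    · rw [row_lt r h]; exact hw _
    · rw [Fin.ext h, row_eq]; exact add_pos (hw _) (hw _)
    · by_cases hr : (r : ℕ) + 1 < d
      · rw [row_gt r hr h]; exact hw _
      · have : r = lastIdx d := Fin.ext (by have := r.isLt; omega)
        rw [this, row_last]; exact hw _
  · change v (lastIdx d) < v p
    rw [row_last, row_eq]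
    exact lt_add_of_pos_left _ (hw _)
  · funext j
    simp only [lenAfterA, ← hpdef]
    split_ifs with h1 h2 h3
    · exact (row_lt j h1).symm
    · rw [Fin.ext h2, row_eq, row_last, add_sub_cancel_right]
    · rw [row_last]
      exact congrArg w (Fin.ext h3)
    · have hj := j.isLt
      rw [row_gt ⟨(j : ℕ) - 1, by omega⟩ (by simp only; omega) (by simp only; omega)]
      exact congrArg w (Fin.ext (by simp only; omega))

theorem lenAfterB_of_matB {d : ℕ} [NeZero d] {π : Equiv.Perm (Fin d)}
    (hp : π.symm (lastIdx d) ≠ lastIdx d) {v w : Fin d → ℝ} (hw : ∀ j, 0 < w j)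
    (hv : ∀ r, v r = ∑ j, (matB π r j : ℝ) * w j) :
    (∀ r, 0 < v r) ∧ stepB ⟨π, v⟩ ∧ w = lenAfterB π v := by
  have row_last : v (lastIdx d) = w (π.symm (lastIdx d)) + w (lastIdx d) := by
    have h : ∀ j, matB π (lastIdx d) j =
        (if j = π.symm (lastIdx d) then 1 else 0) + (if j = lastIdx d then 1 else 0) := by
      intro j
      simp only [matB, Matrix.of_apply, true_and, eq_comm (a := lastIdx d) (b := j)]
      by_cases h : j = π.symm (lastIdx d)
      · rw [if_pos h, if_pos h, if_neg (h.trans_ne hp), add_zero]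
      · rw [if_neg h, if_neg h, zero_add]
    simp [hv, h, add_mul, Finset.sum_add_distrib]
  have row_ne : ∀ r, r ≠ lastIdx d → v r = w r := by
    intro r hr
    simp [hv, matB, hr]
  refine ⟨fun r => ?_, ?_, ?_⟩
  · by_cases h : r = lastIdx d
    · rw [h, row_last]; exact add_pos (hw _) (hw _)
    · rw [row_ne r h]; exact hw _
  · change v (π.symm (lastIdx d)) < v (lastIdx d)
    rw [row_ne _ hp, row_last]
    exact lt_add_of_pos_right _ (hw _)
  · funext j
    simp only [lenAfterB]
    split_ifs with h
    · rw [h, row_last, row_ne _ hp, add_sub_cancel_left]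
    · exact (row_ne j h).symm

theorem not_stepA_of_stepB {d : ℕ} [NeZero d] {T : IET d} (h : stepB T) : ¬ stepA T :=
  lt_asymm h

/-- A Rauzy step is reproduced, with the same type and permutations, by any pair of length
vectors related by its matrix, the second of which is positive. -/
theorem IsRauzyStep.of_stepMat {d : ℕ} [NeZero d] {T T' : IET d} (hT : IsRauzyStep T T')
    {v w : Fin d → ℝ} (hw : ∀ j, 0 < w j)
    (hv : ∀ r, v r = ∑ j, (stepMat T r j : ℝ) * w j) :
    (∀ r, 0 < v r) ∧ IsRauzyStep ⟨T.perm, v⟩ ⟨T'.perm, w⟩ ∧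
      (stepA ⟨T.perm, v⟩ ↔ stepA T) ∧ (stepB ⟨T.perm, v⟩ ↔ stepB T) := by
  rcases hT with ⟨h, hm, -⟩ | ⟨h, hm, -⟩
  · have hp : T.perm.symm (lastIdx d) ≠ lastIdx d := by
      intro e
      rw [stepA, e] at h
      exact lt_irrefl _ h
    simp only [stepMat, if_pos h] at hv
    obtain ⟨h1, h2, h3⟩ := lenAfterA_of_matA hp hw hv
    exact ⟨h1, Or.inl ⟨h2, hm, h3⟩, iff_of_true h2 h,
      iff_of_false (fun hb => not_stepA_of_stepB hb h2) (fun hb => not_stepA_of_stepB hb h)⟩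
  · have hp : T.perm.symm (lastIdx d) ≠ lastIdx d := by
      intro e
      rw [stepB, e] at h
      exact lt_irrefl _ h
    simp only [stepMat, if_neg (not_stepA_of_stepB h)] at hv
    obtain ⟨h1, h2, h3⟩ := lenAfterB_of_matB hp hw hv
    exact ⟨h1, Or.inr ⟨h2, hm, h3⟩,
      iff_of_false (not_stepA_of_stepB h2) (not_stepA_of_stepB h), iff_of_true h2 h⟩

theorem chainMatrixFrom_succ {d N : ℕ} [NeZero d] (c : RauzyChain d N) (a m : ℕ) :
    chainMatrixFrom c a (m + 1) = stepMat (c.seq a) * chainMatrixFrom c (a + 1) m := by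
  simp [chainMatrixFrom, List.range_succ_eq_map, Function.comp_def, Nat.add_right_comm,
    ← Nat.add_assoc]

/-- If `T` admits `n+k` steps of Rauzy induction, `M(R^n(T),k)` is a
positive matrix, and `L` is the normalized `i`-th column of `M(T,n+k)`, then the
IET with lengths `L` and permutation `π(T)` admits (at least) `n` steps of Rauzy
induction, agreeing with `T` through the first `n` steps: same step types, and the
same permutations `π(R^m(S)) = π(R^m(T))` for `m ≤ n`. -/
theorem prescribed_rauzy_induction {d : ℕ} [NeZero d] (n k : ℕ) (T : IET d)
    (hpos : ∀ i, 0 < T.len i)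
    (c : RauzyChain d (n + k)) (hc0 : c.seq 0 = T)
    (hposmat : ∀ i j : Fin d, 0 < chainMatrixFrom c n k i j)
    (i : Fin d) (L : Fin d → ℝ)
    (hL : L = fun r : Fin d =>
      ((chainMatrix c (n + k)) r i : ℝ) / ((colSum (chainMatrix c (n + k)) i : ℤ) : ℝ)) :
    ∃ c' : RauzyChain d n, c'.seq 0 = ⟨T.perm, L⟩ ∧
      (∀ m, m < n → ((stepA (c'.seq m) ↔ stepA (c.seq m)) ∧
        (stepB (c'.seq m) ↔ stepB (c.seq m)))) ∧
      (∀ m, m ≤ n → (c'.seq m).perm = (c.seq m).perm) := by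
  have scaled : ∀ s : ℝ, ∀ m, m < n → ∀ r,
      (chainMatrixFrom c m (n + k - m) r i : ℝ) / s =
        ∑ j, (stepMat (c.seq m) r j : ℝ) *
          ((chainMatrixFrom c (m + 1) (n + k - (m + 1)) j i : ℝ) / s) := by
    intro s m hm r
    rw [show n + k - m = n + k - (m + 1) + 1 by omega, chainMatrixFrom_succ, Matrix.mul_apply]
    push_cast
    rw [Finset.sum_div]
    exact Finset.sum_congr rfl fun j _ => mul_div_assoc _ _ _
  have pos : ∀ s : ℝ, 0 < s → ∀ t, t ≤ n → ∀ r,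
      0 < (chainMatrixFrom c (n - t) (n + k - (n - t)) r i : ℝ) / s := by
    intro s hs t
    induction t with
    | zero =>
      intro _ r
      rw [Nat.sub_zero, Nat.add_sub_cancel_left]
      exact div_pos (by exact_mod_cast hposmat r i) hs
    | succ t ih =>
      intro ht
      have hlt : n - (t + 1) < n := by omega
      have e : n - t = n - (t + 1) + 1 := by omega
      have ih := ih (by omega)
      rw [e] at ih
      exact ((c.step _ (by omega)).of_stepMat ih (scaled s _ hlt)).1
  have hs : (0 : ℝ) < ((colSum (chainMatrix c (n + k)) i : ℤ) : ℝ) := by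
    have h : ∀ r, (0 : ℝ) < (chainMatrix c (n + k) r i : ℝ) := by
      intro r
      simpa [chainMatrix] using pos 1 one_pos n le_rfl r
    rw [colSum]
    push_cast
    exact Finset.sum_pos (fun r _ => h r) ⟨i, Finset.mem_univ i⟩
  have step : ∀ m, m < n → _ := fun m hm =>
    (c.step m (by omega)).of_stepMat
      (by simpa only [Nat.sub_sub_self (Nat.succ_le_of_lt hm)] using
        pos _ hs (n - (m + 1)) (Nat.sub_le _ _))
      (scaled _ m hm)
  refine ⟨⟨fun m => ⟨(c.seq m).perm, fun r =>
      (chainMatrixFrom c m (n + k - m) r i : ℝ) /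
        ((colSum (chainMatrix c (n + k)) i : ℤ) : ℝ)⟩,
    fun m hm => (step m hm).2.1⟩, ?_, fun m hm => (step m hm).2.2, fun _ _ => rfl⟩
  rw [hL, ← hc0]
  rfl

end IETPaper
end

section
/- Let T be an interval exchange transformation on 4 intervals whose permutation lies in the Rauzy class of (4321), admitting n steps of Rauzy induction. Then there exist r ∈ ℕ and a nonempty open set U ⊆ M(T,n)_Δ such that every IET S on 4 intervals with π(S) = π(T) and length vector in U admits n + r steps of Rauzy induction, satisfies π(R^{n+r}(S)) = (4213), and has gcd(|C_2(M(S,n+r))|, |C_3(M(S,n+r))|) = 1. -/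
open Finset MeasureTheory

namespace IETPaper

open Matrix in
theorem intCast_mul_mulVec {d : ℕ} (M N : Matrix (Fin d) (Fin d) ℤ) (v : Fin d → ℝ) :
    (M * N).map (Int.cast : ℤ → ℝ) *ᵥ v =
      M.map (Int.cast : ℤ → ℝ) *ᵥ (N.map (Int.cast : ℤ → ℝ) *ᵥ v) := by
  rw [Matrix.mulVec_mulVec]
  congr 1
  exact Matrix.map_mul (f := Int.castRingHom ℝ)

theorem symm_last_eq_or {p : Equiv.Perm (Fin 4)} (hp : p.symm (lastIdx 4) ≠ lastIdx 4) :
    p.symm (lastIdx 4) = 0 ∨ p.symm (lastIdx 4) = 1 ∨ p.symm (lastIdx 4) = 2 := by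
  generalize p.symm (lastIdx 4) = k at hp ⊢
  revert k
  decide

open Matrix in
/-- The action of a type `a` matrix on length vectors is inverse to Rauzy induction, and it
preserves positivity. -/
theorem matA_mulVec {p : Equiv.Perm (Fin 4)} (hp : p.symm (lastIdx 4) ≠ lastIdx 4)
    {w : Fin 4 → ℝ} (hw : ∀ i, 0 < w i) :
    (∀ i, 0 < ((matA p).map (Int.cast : ℤ → ℝ) *ᵥ w) i) ∧
      stepA ⟨p, (matA p).map (Int.cast : ℤ → ℝ) *ᵥ w⟩ ∧
      w = lenAfterA p ((matA p).map (Int.cast : ℤ → ℝ) *ᵥ w) := by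
  have h0 := hw 0
  have h1 := hw 1
  have h2 := hw 2
  have h3 := hw 3
  unfold stepA lenAfterA
  refine ⟨fun i => ?_, ?_, funext fun i => ?_⟩ <;>
    obtain hk | hk | hk := symm_last_eq_or hp <;> simp only [matA, hk]
  iterate 3
    fin_cases i <;>
      simp [Matrix.mulVec, dotProduct, Fin.sum_univ_four, lastIdx] <;> linarith
  iterate 3
    simp [Matrix.mulVec, dotProduct, Fin.sum_univ_four, lastIdx]; linarith
  all_goals
    fin_cases i <;> simp [Matrix.mulVec, dotProduct, Fin.sum_univ_four, lastIdx]

open Matrix in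
/-- The action of a type `b` matrix on length vectors is inverse to Rauzy induction, and it
preserves positivity. -/
theorem matB_mulVec {p : Equiv.Perm (Fin 4)} (hp : p.symm (lastIdx 4) ≠ lastIdx 4)
    {w : Fin 4 → ℝ} (hw : ∀ i, 0 < w i) :
    (∀ i, 0 < ((matB p).map (Int.cast : ℤ → ℝ) *ᵥ w) i) ∧
      stepB ⟨p, (matB p).map (Int.cast : ℤ → ℝ) *ᵥ w⟩ ∧
      w = lenAfterB p ((matB p).map (Int.cast : ℤ → ℝ) *ᵥ w) := by
  have h0 := hw 0
  have h1 := hw 1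
  have h2 := hw 2
  have h3 := hw 3
  unfold stepB lenAfterB
  refine ⟨fun i => ?_, ?_, funext fun i => ?_⟩ <;>
    obtain hk | hk | hk := symm_last_eq_or hp <;> simp only [matB, hk]
  iterate 3
    fin_cases i <;>
      simp [Matrix.mulVec, dotProduct, Fin.sum_univ_four, lastIdx] <;> linarith
  iterate 3
    simp [Matrix.mulVec, dotProduct, Fin.sum_univ_four, lastIdx]; linarith
  all_goals
    fin_cases i <;> simp [Matrix.mulVec, dotProduct, Fin.sum_univ_four, lastIdx]

theorem isUnit_matA {p : Equiv.Perm (Fin 4)} (hp : p.symm (lastIdx 4) ≠ lastIdx 4) :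
    IsUnit (matA p) := by
  rw [Matrix.isUnit_iff_isUnit_det]
  obtain hk | hk | hk := symm_last_eq_or hp <;> simp only [matA, hk] <;>
    simp [Matrix.det_succ_row_zero, Fin.sum_univ_succ, Fin.succAbove, lastIdx]

theorem isUnit_matB {p : Equiv.Perm (Fin 4)} (hp : p.symm (lastIdx 4) ≠ lastIdx 4) :
    IsUnit (matB p) := by
  rw [Matrix.isUnit_iff_isUnit_det]
  have : matB p = Matrix.transvection (lastIdx 4) (p.symm (lastIdx 4)) 1 := by
    ext i j
    simp only [matB, Matrix.of_apply, Matrix.transvection, Matrix.add_apply, Matrix.one_apply,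
      Matrix.single_apply]
    split_ifs <;> grind
  rw [this, Matrix.det_transvection_of_ne _ _ hp.symm]
  exact isUnit_one

/-- `RauzyPath p q n M`: there is a path of `n` moves from `p` to `q` in the Rauzy diagram on
four letters, and `M` is the product of the matrices of its moves. -/
inductive RauzyPath : Equiv.Perm (Fin 4) → Equiv.Perm (Fin 4) → ℕ →
    Matrix (Fin 4) (Fin 4) ℤ → Prop
  | nil (p) : RauzyPath p p 0 1
  | consA {p q r n M} : p.symm (lastIdx 4) ≠ lastIdx 4 → RauzyMoveA p q → RauzyPath q r n M →
      RauzyPath p r (n + 1) (matA p * M)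
  | consB {p q r n M} : p.symm (lastIdx 4) ≠ lastIdx 4 → RauzyMoveB p q → RauzyPath q r n M →
      RauzyPath p r (n + 1) (matB p * M)

namespace RauzyPath

variable {p q r : Equiv.Perm (Fin 4)} {m n : ℕ} {M N : Matrix (Fin 4) (Fin 4) ℤ}

theorem trans (h : RauzyPath p q m M) (h' : RauzyPath q r n N) :
    RauzyPath p r (m + n) (M * N) := by
  induction h with
  | nil => simpa using h'
  | consA hp hm _ ih =>
    rw [mul_assoc, Nat.add_right_comm]
    exact consA hp hm (ih h')
  | consB hp hm _ ih =>
    rw [mul_assoc, Nat.add_right_comm]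
    exact consB hp hm (ih h')

theorem singleA (hp : p.symm (lastIdx 4) ≠ lastIdx 4) (h : RauzyMoveA p q) :
    RauzyPath p q 1 (matA p) := by
  simpa using consA hp h (nil q)

theorem singleB (hp : p.symm (lastIdx 4) ≠ lastIdx 4) (h : RauzyMoveB p q) :
    RauzyPath p q 1 (matB p) := by
  simpa using consB hp h (nil q)

theorem isUnit (h : RauzyPath p q n M) : IsUnit M := by
  induction h with
  | nil => exact isUnit_one
  | consA hp _ _ ih => exact (isUnit_matA hp).mul ih
  | consB hp _ _ ih => exact (isUnit_matB hp).mul ih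

open Matrix in
theorem mulVec_pos (h : RauzyPath p q n M) {v : Fin 4 → ℝ} (hv : ∀ i, 0 < v i) (i : Fin 4) :
    0 < (M.map (Int.cast : ℤ → ℝ) *ᵥ v) i := by
  induction h generalizing i with
  | nil => simpa using hv i
  | consA hp _ _ ih =>
    rw [intCast_mul_mulVec]
    exact (matA_mulVec hp ih).1 i
  | consB hp _ _ ih =>
    rw [intCast_mul_mulVec]
    exact (matB_mulVec hp ih).1 i

end RauzyPath

theorem stepMat_of_stepA {d : ℕ} [NeZero d] {T : IET d} (h : stepA T) :
    stepMat T = matA T.perm := if_pos h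

theorem stepMat_of_stepB {d : ℕ} [NeZero d] {T : IET d} (h : stepB T) :
    stepMat T = matB T.perm := if_neg (lt_asymm h)

/-- Prepending one step of Rauzy induction to a chain. -/
def RauzyChain.cons {d n : ℕ} [NeZero d] (S : IET d) (c : RauzyChain d n)
    (h : IsRauzyStep S (c.seq 0)) : RauzyChain d (n + 1) where
  seq
    | 0 => S
    | i + 1 => c.seq i
  step
    | 0, _ => h
    | i + 1, hi => c.step i (Nat.lt_of_succ_lt_succ hi)

theorem chainMatrix_cons {d n : ℕ} [NeZero d] (S : IET d) (c : RauzyChain d n)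
    (h : IsRauzyStep S (c.seq 0)) (m : ℕ) :
    chainMatrix (c.cons S h) (m + 1) = stepMat S * chainMatrix c m := by
  simp [chainMatrix, chainMatrixFrom, List.range_succ_eq_map, Function.comp_def,
    RauzyChain.cons]

theorem chainMatrix_succ {d n : ℕ} [NeZero d] (c : RauzyChain d n) (m : ℕ) :
    chainMatrix c (m + 1) = chainMatrix c m * stepMat (c.seq m) := by
  simp [chainMatrix, chainMatrixFrom, List.range_succ]

open Matrix in
/-- Every interval exchange whose lengths lie in the open cone of a Rauzy path follows it. -/
theorem RauzyPath.exists_chain {p q : Equiv.Perm (Fin 4)} {n : ℕ}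
    {M : Matrix (Fin 4) (Fin 4) ℤ} (h : RauzyPath p q n M) {v : Fin 4 → ℝ}
    (hv : ∀ i, 0 < v i) :
    ∃ c : RauzyChain 4 n, c.seq 0 = ⟨p, M.map (Int.cast : ℤ → ℝ) *ᵥ v⟩ ∧
      (c.seq n).perm = q ∧ chainMatrix c n = M := by
  induction h with
  | nil p =>
    exact ⟨⟨fun _ => ⟨p, v⟩, fun i hi => absurd hi (Nat.not_lt_zero i)⟩, by simp, rfl, by
      simp [chainMatrix, chainMatrixFrom]⟩
  | @consA p q r n M hp hm hpath ih =>
    obtain ⟨c, hc0, hcn, hcM⟩ := ih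
    obtain ⟨-, hstep, hlen⟩ := matA_mulVec hp (hpath.mulVec_pos hv)
    have hS : IsRauzyStep ⟨p, (matA p).map (Int.cast : ℤ → ℝ) *ᵥ
        (M.map (Int.cast : ℤ → ℝ) *ᵥ v)⟩ (c.seq 0) := by
      rw [hc0]
      exact .inl ⟨hstep, hm, hlen⟩
    refine ⟨c.cons _ hS, ?_, hcn, ?_⟩
    · rw [intCast_mul_mulVec]
      rfl
    · rw [chainMatrix_cons, stepMat_of_stepA hstep, hcM]
  | @consB p q r n M hp hm hpath ih =>
    obtain ⟨c, hc0, hcn, hcM⟩ := ih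
    obtain ⟨-, hstep, hlen⟩ := matB_mulVec hp (hpath.mulVec_pos hv)
    have hS : IsRauzyStep ⟨p, (matB p).map (Int.cast : ℤ → ℝ) *ᵥ
        (M.map (Int.cast : ℤ → ℝ) *ᵥ v)⟩ (c.seq 0) := by
      rw [hc0]
      exact .inr ⟨hstep, hm, hlen⟩
    refine ⟨c.cons _ hS, ?_, hcn, ?_⟩
    · rw [intCast_mul_mulVec]
      rfl
    · rw [chainMatrix_cons, stepMat_of_stepB hstep, hcM]

theorem RauzyChain.rauzyPath {n : ℕ} (c : RauzyChain 4 n) {m : ℕ} (hm : m ≤ n) :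
    RauzyPath (c.seq 0).perm (c.seq m).perm m (chainMatrix c m) := by
  induction m with
  | zero => simpa [chainMatrix, chainMatrixFrom] using RauzyPath.nil (c.seq 0).perm
  | succ m ih =>
    rw [chainMatrix_succ]
    refine (ih (by omega)).trans ?_
    rcases c.step m hm with ⟨hs, hmove, -⟩ | ⟨hs, hmove, -⟩
    · rw [stepMat_of_stepA hs]
      exact .singleA (fun he => hs.ne (by rw [he])) hmove
    · rw [stepMat_of_stepB hs]
      exact .singleB (fun he => hs.ne (by rw [he])) hmove

theorem RauzyPath.inRauzyClass {π₀ p q : Equiv.Perm (Fin 4)} {n : ℕ}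
    {M : Matrix (Fin 4) (Fin 4) ℤ} (h : RauzyPath p q n M) (hp : InRauzyClass π₀ p) :
    InRauzyClass π₀ q := by
  induction h with
  | nil => exact hp
  | consA _ hm _ ih => exact ih (hp.tail (.inl hm))
  | consB _ hm _ ih => exact ih (hp.tail (.inr hm))

/-- The permutation `(4132)`. -/
def perm4132 : Equiv.Perm (Fin 4) := ⟨![3, 0, 2, 1], ![1, 3, 2, 0], by decide, by decide⟩

/-- The permutation `(2431)`. -/
def perm2431 : Equiv.Perm (Fin 4) := ⟨![1, 3, 2, 0], ![3, 0, 2, 1], by decide, by decide⟩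

/-- The permutation `(3241)`. -/
def perm3241 : Equiv.Perm (Fin 4) := ⟨![2, 1, 3, 0], ![3, 1, 0, 2], by decide, by decide⟩

/-- The permutation `(3142)`. -/
def perm3142 : Equiv.Perm (Fin 4) := ⟨![2, 0, 3, 1], ![1, 3, 0, 2], by decide, by decide⟩

/-- The permutation `(2413)`. -/
def perm2413 : Equiv.Perm (Fin 4) := ⟨![1, 3, 0, 2], ![2, 0, 3, 1], by decide, by decide⟩

theorem RauzyMoveA.unique {d : ℕ} [NeZero d] {p q q' : Equiv.Perm (Fin d)}
    (h : RauzyMoveA p q) (h' : RauzyMoveA p q') : q = q' := by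
  ext j
  obtain ⟨h1, h2, h3⟩ := h j
  obtain ⟨h1', h2', h3'⟩ := h' j
  rcases lt_trichotomy (j : ℕ) ((p.symm (lastIdx d) : ℕ) + 1) with hj | hj | hj
  · rw [h1 (by omega), h1' (by omega)]
  · rw [h2 hj, h2' hj]
  · rw [h3 hj, h3' hj]

theorem RauzyMoveB.unique {d : ℕ} [NeZero d] {p q q' : Equiv.Perm (Fin d)}
    (h : RauzyMoveB p q) (h' : RauzyMoveB p q') : q = q' := by
  ext j
  obtain ⟨h1, h2, h3⟩ := h j
  obtain ⟨h1', h2', h3'⟩ := h' j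
  rcases le_or_gt (p j : ℕ) (p (lastIdx d) : ℕ) with hj | hj
  · rw [h1 hj, h1' hj]
  · rcases (Nat.le_sub_one_of_lt (p j).isLt).lt_or_eq with hd | hd
    · rw [h2 hj hd, h2' hj hd]
    · rw [h3 hd, h3' hd]

theorem moveA_4321 : RauzyMoveA perm4321 perm4132 := by unfold RauzyMoveA; decide
theorem moveA_4132 : RauzyMoveA perm4132 perm4213 := by unfold RauzyMoveA; decide
theorem moveA_4213 : RauzyMoveA perm4213 perm4321 := by unfold RauzyMoveA; decide
theorem moveA_2431 : RauzyMoveA perm2431 perm2413 := by unfold RauzyMoveA; decide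
theorem moveA_2413 : RauzyMoveA perm2413 perm2431 := by unfold RauzyMoveA; decide
theorem moveA_3241 : RauzyMoveA perm3241 perm3241 := by unfold RauzyMoveA; decide
theorem moveA_3142 : RauzyMoveA perm3142 perm3142 := by unfold RauzyMoveA; decide
theorem moveB_4321 : RauzyMoveB perm4321 perm2431 := by unfold RauzyMoveB; decide
theorem moveB_2431 : RauzyMoveB perm2431 perm3241 := by unfold RauzyMoveB; decide
theorem moveB_3241 : RauzyMoveB perm3241 perm4321 := by unfold RauzyMoveB; decide
theorem moveB_4132 : RauzyMoveB perm4132 perm3142 := by unfold RauzyMoveB; decide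
theorem moveB_3142 : RauzyMoveB perm3142 perm4132 := by unfold RauzyMoveB; decide
theorem moveB_4213 : RauzyMoveB perm4213 perm4213 := by unfold RauzyMoveB; decide
theorem moveB_2413 : RauzyMoveB perm2413 perm2413 := by unfold RauzyMoveB; decide

/-- The Rauzy class of `(4321)` consists of seven permutations. -/
theorem InRauzyClass.eq_or {p : Equiv.Perm (Fin 4)} (h : InRauzyClass perm4321 p) :
    p = perm4321 ∨ p = perm4132 ∨ p = perm4213 ∨ p = perm2431 ∨ p = perm3241 ∨
      p = perm3142 ∨ p = perm2413 := by
  induction h with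
  | refl => exact .inl rfl
  | tail _ hm ih =>
    rcases ih with rfl | rfl | rfl | rfl | rfl | rfl | rfl <;> rcases hm with hm | hm
    · simp [hm.unique moveA_4321]
    · simp [hm.unique moveB_4321]
    · simp [hm.unique moveA_4132]
    · simp [hm.unique moveB_4132]
    · simp [hm.unique moveA_4213]
    · simp [hm.unique moveB_4213]
    · simp [hm.unique moveA_2431]
    · simp [hm.unique moveB_2431]
    · simp [hm.unique moveA_3241]
    · simp [hm.unique moveB_3241]
    · simp [hm.unique moveA_3142]
    · simp [hm.unique moveB_3142]
    · simp [hm.unique moveA_2413]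
    · simp [hm.unique moveB_2413]

theorem InRauzyClass.exists_path_4213 {p : Equiv.Perm (Fin 4)}
    (h : InRauzyClass perm4321 p) : ∃ n M, RauzyPath p perm4213 n M := by
  have h4132 := RauzyPath.singleA (by decide) moveA_4132
  have h4321 := RauzyPath.consA (by decide) moveA_4321 h4132
  have h3241 := RauzyPath.consB (by decide) moveB_3241 h4321
  have h2431 := RauzyPath.consB (by decide) moveB_2431 h3241
  rcases h.eq_or with rfl | rfl | rfl | rfl | rfl | rfl | rfl
  · exact ⟨_, _, h4321⟩
  · exact ⟨_, _, h4132⟩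
  · exact ⟨_, _, .nil _⟩
  · exact ⟨_, _, h2431⟩
  · exact ⟨_, _, h3241⟩
  · exact ⟨_, _, .consB (by decide) moveB_3142 h4132⟩
  · exact ⟨_, _, .consA (by decide) moveA_2413 h2431⟩

theorem colSum_mul {d : ℕ} (M N : Matrix (Fin d) (Fin d) ℤ) (j : Fin d) :
    colSum (M * N) j = ∑ k, colSum M k * N k j := by
  simp only [colSum, Matrix.mul_apply, Finset.sum_mul]
  exact Finset.sum_comm

theorem colSum_one {d : ℕ} (j : Fin d) : colSum (1 : Matrix (Fin d) (Fin d) ℤ) j = 1 := by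
  simp [colSum, Matrix.one_apply]

theorem colSum_mul_matA_pos {p : Equiv.Perm (Fin 4)} (hp : p.symm (lastIdx 4) ≠ lastIdx 4)
    {M : Matrix (Fin 4) (Fin 4) ℤ} (hM : ∀ j, 0 < colSum M j) (j : Fin 4) :
    0 < colSum (M * matA p) j := by
  have h0 := hM 0
  have h1 := hM 1
  have h2 := hM 2
  have h3 := hM 3
  rw [colSum_mul]
  obtain hk | hk | hk := symm_last_eq_or hp <;> simp only [matA, hk] <;> fin_cases j <;>
    simp [Fin.sum_univ_four, lastIdx] <;> linarith

theorem colSum_mul_matB_pos {p : Equiv.Perm (Fin 4)} (hp : p.symm (lastIdx 4) ≠ lastIdx 4)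
    {M : Matrix (Fin 4) (Fin 4) ℤ} (hM : ∀ j, 0 < colSum M j) (j : Fin 4) :
    0 < colSum (M * matB p) j := by
  have h0 := hM 0
  have h1 := hM 1
  have h2 := hM 2
  have h3 := hM 3
  rw [colSum_mul]
  obtain hk | hk | hk := symm_last_eq_or hp <;> simp only [matB, hk] <;> fin_cases j <;>
    simp [Fin.sum_univ_four, lastIdx] <;> linarith

theorem RauzyPath.colSum_pos {p q : Equiv.Perm (Fin 4)} {n : ℕ}
    {M : Matrix (Fin 4) (Fin 4) ℤ} (h : RauzyPath p q n M) (j : Fin 4) : 0 < colSum M j := by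
  suffices ∀ N : Matrix (Fin 4) (Fin 4) ℤ, (∀ j, 0 < colSum N j) → 0 < colSum (N * M) j by
    simpa using this 1 fun j => by simp [colSum_one]
  induction h with
  | nil => simp_all
  | consA hp _ _ ih =>
    intro N hN
    rw [← mul_assoc]
    exact ih _ (colSum_mul_matA_pos hp hN)
  | consB hp _ _ ih =>
    intro N hN
    rw [← mul_assoc]
    exact ih _ (colSum_mul_matB_pos hp hN)

/-- Winding `m` times around the loop of type `b` at `(4213)`. -/
theorem exists_loopB_4213 (m : ℕ) : ∃ n N, RauzyPath perm4213 perm4213 n N ∧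
    ∀ M : Matrix (Fin 4) (Fin 4) ℤ, colSum (M * N) =
      ![colSum M 0 + m * colSum M 3, colSum M 1, colSum M 2, colSum M 3] := by
  induction m with
  | zero =>
    refine ⟨_, _, .nil _, fun M => funext fun j => ?_⟩
    fin_cases j <;> simp
  | succ m ih =>
    obtain ⟨n, N, hN, hc⟩ := ih
    refine ⟨_, _, hN.trans (.singleB (by decide) moveB_4213), fun M => funext fun j => ?_⟩
    rw [← mul_assoc, colSum_mul, hc]
    fin_cases j <;> simp [Fin.sum_univ_four, matB, perm4213, lastIdx]
    ring

/-- Winding `m` times around the cycle of type `a` through `(4213)`. -/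
theorem exists_loopA_4213 (m : ℕ) : ∃ n N, RauzyPath perm4213 perm4213 n N ∧
    ∀ M : Matrix (Fin 4) (Fin 4) ℤ, colSum (M * N) =
      ![colSum M 0, colSum M 1 + m * colSum M 0, colSum M 2 + m * colSum M 0,
        colSum M 3 + m * colSum M 0] := by
  induction m with
  | zero =>
    refine ⟨_, _, .nil _, fun M => funext fun j => ?_⟩
    fin_cases j <;> simp
  | succ m ih =>
    obtain ⟨n, N, hN, hc⟩ := ih
    refine ⟨_, _, ((hN.trans (.singleA (by decide) moveA_4213)).trans
      (.singleA (by decide) moveA_4321)).trans (.singleA (by decide) moveA_4132),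
      fun M => funext fun j => ?_⟩
    simp only [← mul_assoc, colSum_mul _ (matA _), hc]
    fin_cases j <;>
      simp [Fin.sum_univ_four, matA, perm4213, perm4321, perm4132, lastIdx] <;> ring

/-- A loop at `(4213)` after which the second and third columns have different sums. -/
theorem exists_loop_4213_ne : ∃ n N, RauzyPath perm4213 perm4213 n N ∧
    ∀ M : Matrix (Fin 4) (Fin 4) ℤ,
      colSum (M * N) 1 - colSum (M * N) 2 = colSum M 1 := by
  refine ⟨_, _, .consA (by decide) moveA_4213 <| .consB (by decide) moveB_4321 <|
    .consB (by decide) moveB_2431 <| .consB (by decide) moveB_3241 <|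
    .consA (by decide) moveA_4321 <| .singleA (by decide) moveA_4132, fun M => ?_⟩
  simp only [← mul_assoc, colSum_mul _ (matA _), colSum_mul _ (matB _)]
  simp [Fin.sum_univ_four, matA, matB, perm4213, perm4321, perm4132, perm2431, perm3241, lastIdx]

/-- The column sums of an invertible integer matrix have no common factor. -/
theorem isUnit_of_dvd_colSum {d : ℕ} [NeZero d] {M : Matrix (Fin d) (Fin d) ℤ} (hM : IsUnit M)
    {g : ℤ} (hg : ∀ j, g ∣ colSum M j) : IsUnit g := by
  obtain ⟨N, hN⟩ := hM.exists_right_inv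
  have h := colSum_mul M N (firstIdx d)
  rw [hN, colSum_one] at h
  rw [isUnit_iff_dvd_one, h]
  exact Finset.dvd_sum fun k _ => (hg k).mul_right _

/-- If `x`, `y`, `z` have no common factor and `z ≠ 0`, some `x + m * y` is coprime to `z`. -/
theorem exists_isCoprime_add_mul {x y z : ℤ} (hz : z ≠ 0)
    (h : ∀ p : ℕ, p.Prime → (p : ℤ) ∣ x → (p : ℤ) ∣ y → ¬ (p : ℤ) ∣ z) :
    ∃ m : ℕ, IsCoprime (x + m * y) z := by
  classical
  refine ⟨∏ p ∈ z.natAbs.primeFactors.filter (fun p : ℕ => ¬ (p : ℤ) ∣ x), p, ?_⟩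
  rw [Int.isCoprime_iff_gcd_eq_one]
  by_contra hne
  obtain ⟨p, hp, hpg⟩ := Nat.exists_prime_and_dvd hne
  have hpg' : (p : ℤ) ∣ _ := Int.natCast_dvd_natCast.2 hpg
  have hpx := hpg'.trans (Int.gcd_dvd_left _ _)
  have hpz := hpg'.trans (Int.gcd_dvd_right _ _)
  by_cases hx : (p : ℤ) ∣ x
  · rcases (Nat.prime_iff_prime_int.1 hp).dvd_or_dvd ((dvd_add_right hx).1 hpx) with hm | hy
    · obtain ⟨q, hq, hpq⟩ := (hp.prime.dvd_finsetProd_iff _).1 (Int.natCast_dvd_natCast.1 hm)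
      rw [Finset.mem_filter, Nat.mem_primeFactors] at hq
      rw [(Nat.prime_dvd_prime_iff_eq hp hq.1.1).1 hpq] at hx
      exact hq.2 hx
    · exact h p hp hx hy hpz
  · refine hx ((dvd_add_left (Dvd.dvd.mul_right (Int.natCast_dvd_natCast.2
      (Finset.dvd_prod_of_mem (fun p => p) ?_)) y)).1 hpx)
    rw [Finset.mem_filter, Nat.mem_primeFactors]
    exact ⟨⟨hp, Int.natCast_dvd.1 hpz, Int.natAbs_ne_zero.2 hz⟩, hx⟩

theorem exists_isCoprime_add_mul_add_mul {a b c d : ℤ} (hbc : b ≠ c)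
    (h : ∀ p : ℕ, p.Prime → (p : ℤ) ∣ a → (p : ℤ) ∣ b → (p : ℤ) ∣ c → ¬ (p : ℤ) ∣ d) :
    ∃ m k : ℕ, IsCoprime (b + k * (a + m * d)) (c + k * (a + m * d)) := by
  have hg : ((Int.gcd b c : ℕ) : ℤ) ≠ 0 := by
    rw [Nat.cast_ne_zero, Ne, Int.gcd_eq_zero_iff]
    rintro ⟨rfl, rfl⟩
    exact hbc rfl
  obtain ⟨m, hm⟩ := exists_isCoprime_add_mul (x := a) (y := d) hg fun p hp ha hd hbc =>
    h p hp ha (hbc.trans (Int.gcd_dvd_left _ _)) (hbc.trans (Int.gcd_dvd_right _ _)) hd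
  obtain ⟨k, hk⟩ := exists_isCoprime_add_mul (x := b) (y := a + m * d) (sub_ne_zero.2 hbc)
    fun p hp hb had hsub => (Nat.prime_iff_prime_int.1 hp).not_isUnit <|
      hm.isUnit_of_dvd' had (Int.dvd_coe_gcd hb ((dvd_sub_right hb).1 hsub))
  refine ⟨m, k, ?_⟩
  rw [show c + k * (a + m * d) = -(b - c) + (b + k * (a + m * d)) * 1 by ring]
  exact hk.neg_right.add_mul_left_right 1

/-- Any Rauzy path starting in the class of `(4321)` extends to one which ends at `(4213)` and
whose matrix has coprime second and third column sums. -/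
theorem RauzyPath.exists_extension {p q : Equiv.Perm (Fin 4)} {n : ℕ}
    {M : Matrix (Fin 4) (Fin 4) ℤ} (h : RauzyPath p q n M) (hp : InRauzyClass perm4321 p) :
    ∃ r N, RauzyPath q perm4213 r N ∧ IsCoprime (colSum (M * N) 1) (colSum (M * N) 2) := by
  obtain ⟨r₁, N₁, h₁⟩ := (h.inRauzyClass hp).exists_path_4213
  obtain ⟨r₂, N₂, h₂, hc₂⟩ := exists_loop_4213_ne
  have hpath := h₁.trans h₂
  have hne : colSum (M * (N₁ * N₂)) 1 ≠ colSum (M * (N₁ * N₂)) 2 := by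
    rw [← sub_ne_zero, ← mul_assoc, hc₂]
    exact ((h.trans h₁).colSum_pos 1).ne'
  obtain ⟨m, k, hmk⟩ := exists_isCoprime_add_mul_add_mul hne
    (a := colSum (M * (N₁ * N₂)) 0) (d := colSum (M * (N₁ * N₂)) 3) fun g hg h0 h1 h2 h3 =>
      (Nat.prime_iff_prime_int.1 hg).not_isUnit <|
        isUnit_of_dvd_colSum (h.trans hpath).isUnit fun j => by fin_cases j <;> assumption
  obtain ⟨r₃, N₃, h₃, hc₃⟩ := exists_loopB_4213 m
  obtain ⟨r₄, N₄, h₄, hc₄⟩ := exists_loopA_4213 k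
  refine ⟨_, _, (hpath.trans h₃).trans h₄, ?_⟩
  rw [← mul_assoc M, hc₄, ← mul_assoc M, hc₃]
  simpa using hmk

open Matrix in
/-- The image of the open positive cone under an invertible integer matrix is open. -/
theorem isOpen_cone {d : ℕ} {M : Matrix (Fin d) (Fin d) ℤ} (hM : IsUnit M) :
    IsOpen {L : Fin d → ℝ | ∃ v : Fin d → ℝ, (∀ i, 0 < v i) ∧
      L = M.map (Int.cast : ℤ → ℝ) *ᵥ v} := by
  obtain ⟨N, hMN, hNM⟩ := isUnit_iff_exists.1 hM
  have hone (v : Fin d → ℝ) : (1 : Matrix (Fin d) (Fin d) ℤ).map (Int.cast : ℤ → ℝ) *ᵥ v = v := by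
    simp
  have : {L : Fin d → ℝ | ∃ v : Fin d → ℝ, (∀ i, 0 < v i) ∧
      L = M.map (Int.cast : ℤ → ℝ) *ᵥ v} =
      ⋂ i, {L | 0 < (N.map (Int.cast : ℤ → ℝ) *ᵥ L) i} := by
    ext L
    simp only [Set.mem_ofPred_eq, Set.mem_iInter]
    constructor
    · rintro ⟨v, hv, rfl⟩
      rwa [← intCast_mul_mulVec, hNM, hone]
    · intro hL
      exact ⟨_, hL, by rw [← intCast_mul_mulVec, hMN, hone]⟩
  rw [this]
  refine isOpen_iInter_of_finite fun i => isOpen_lt continuous_const ?_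
  exact (continuous_apply i).comp (continuous_const.matrix_mulVec continuous_id)

/-- For a 4-IET `T` whose permutation lies in the Rauzy class of
`(4321)`, admitting `n` steps of Rauzy induction, there are `r ∈ ℕ` and a nonempty
relatively open `U ⊆ M(T,n)_Δ` such that every 4-IET `S` with `π(S) = π(T)` and
lengths in `U` admits `n + r` steps, ends at permutation `(4213)`, and has
`gcd(|C₂(M(S,n+r))|, |C₃(M(S,n+r))|) = 1`. -/
theorem relatively_prime_columns (n : ℕ) (T : IET 4)
    (hclass : InRauzyClass perm4321 T.perm) (hpos : ∀ i, 0 < T.len i)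
    (c : RauzyChain 4 n) (hc0 : c.seq 0 = T) :
    ∃ r : ℕ, ∃ U : Set (Fin 4 → ℝ), U ⊆ matSimplex (chainMatrix c n) ∧
      U.Nonempty ∧ IsOpen ((Subtype.val ⁻¹' U) : Set (stdSimplex ℝ (Fin 4))) ∧
      ∀ S : IET 4, S.perm = T.perm → S.len ∈ U →
        ∃ c' : RauzyChain 4 (n + r), c'.seq 0 = S ∧
          (c'.seq (n + r)).perm = perm4213 ∧
          Int.gcd (colSum (chainMatrix c' (n + r)) 1)
            (colSum (chainMatrix c' (n + r)) 2) = 1 := by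
  subst hc0
  have hc := c.rauzyPath le_rfl
  obtain ⟨r, N, hN, hcop⟩ := hc.exists_extension hclass
  have hMN := hc.trans hN
  refine ⟨r, {L | ∃ v : Fin 4 → ℝ, (∀ i, 0 < v i) ∧
      L = ((chainMatrix c n * N).map (Int.cast : ℤ → ℝ)).mulVec v} ∩ {L | ∑ i, L i = 1},
    ?_, ?_, ?_, ?_⟩
  · rintro L ⟨⟨v, hv, rfl⟩, hsum⟩
    exact ⟨⟨_, fun i => (hN.mulVec_pos hv i).le, intCast_mul_mulVec _ _ _⟩, hMN.mulVec_pos hv, hsum⟩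
  · have hpos' := hMN.mulVec_pos (v := fun _ => 1) fun _ => one_pos
    set w := ((chainMatrix c n * N).map (Int.cast : ℤ → ℝ)).mulVec fun _ => 1 with hw
    have hs : 0 < ∑ i, w i := Finset.sum_pos (fun i _ => hpos' i) Finset.univ_nonempty
    refine ⟨(∑ i, w i)⁻¹ • w, ⟨(∑ i, w i)⁻¹ • fun _ => 1, fun i => ?_, ?_⟩, ?_⟩
    · simpa using hs
    · rw [Matrix.mulVec_smul, ← hw]
    · simp only [Set.mem_ofPred_eq, Pi.smul_apply, smul_eq_mul, ← Finset.mul_sum]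
      exact inv_mul_cancel₀ hs.ne'
  · convert (isOpen_cone hMN.isUnit).preimage
      (continuous_subtype_val (p := (· ∈ stdSimplex ℝ (Fin 4)))) using 1
    ext L
    simp only [Set.mem_preimage, Set.mem_inter_iff, Set.mem_ofPred_eq, and_iff_left_iff_imp]
    exact fun _ => L.2.2
  · rintro ⟨p, L⟩ rfl ⟨⟨v, hv, rfl⟩, -⟩
    obtain ⟨c', hc'0, hc'n, hc'M⟩ := hMN.exists_chain hv
    refine ⟨c', hc'0, hc'n, ?_⟩
    rw [hc'M]
    exact Int.isCoprime_iff_gcd_eq_one.1 hcop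

end IETPaper
end

section
/- For every d ≥ 2 and every irreducible permutation π of {1,…,d}, the set of length vectors L ∈ Δ_{d−1} with all entries strictly positive such that the interval exchange transformation T_{L,π} satisfies the Keane condition is a residual subset of Δ_{d−1}: it is a Gδ set and contains a dense Gδ subset of Δ_{d−1}. -/
open Finset MeasureTheory

namespace IETPaper

section Intervals

variable {d : ℕ}

lemma leftEnd_add_le {L : Fin d → ℝ} (hL : ∀ i, 0 ≤ L i) {j k : Fin d} (hjk : j < k) :
    leftEnd L j + L j ≤ leftEnd L k := by
  have hj : j ∉ Finset.univ.filter (fun i : Fin d => i < j) := by simp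
  rw [leftEnd, add_comm, ← Finset.sum_insert hj]
  refine Finset.sum_le_sum_of_subset_of_nonneg (fun i hi => ?_) (fun i _ _ => hL i)
  simp only [Finset.mem_insert, Finset.mem_filter, Finset.mem_univ, true_and] at hi ⊢
  rcases hi with rfl | hi
  · exact hjk
  · exact hi.trans hjk

lemma eq_of_mem_Ico_leftEnd {L : Fin d → ℝ} (hL : ∀ i, 0 ≤ L i) {j k : Fin d} {x : ℝ}
    (hj : x ∈ Set.Ico (leftEnd L j) (leftEnd L j + L j))
    (hk : x ∈ Set.Ico (leftEnd L k) (leftEnd L k + L k)) : j = k := by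
  rcases lt_trichotomy j k with h | h | h
  · exact absurd (leftEnd_add_le hL h) (by linarith [hj.2, hk.1])
  · exact h
  · exact absurd (leftEnd_add_le hL h) (by linarith [hk.2, hj.1])

lemma exists_mem_Ico_leftEnd {L : Fin d → ℝ} {x : ℝ} (h0 : 0 ≤ x) (h1 : x < ∑ i, L i) :
    ∃ j, x ∈ Set.Ico (leftEnd L j) (leftEnd L j + L j) := by
  have hd : 0 < d := by
    rcases Nat.eq_zero_or_pos d with rfl | h
    · simp at h1; linarith
    · exact h
  have hne : (Finset.univ.filter (fun j : Fin d => leftEnd L j ≤ x)).Nonempty := by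
    refine ⟨⟨0, hd⟩, ?_⟩
    have : Finset.univ.filter (fun k : Fin d => k < ⟨0, hd⟩) = ∅ := by
      ext k; simp [Fin.lt_def]
    rw [Finset.mem_filter, leftEnd, this, Finset.sum_empty]
    exact ⟨Finset.mem_univ _, h0⟩
  obtain ⟨j, hj, hmax⟩ := Finset.exists_max_image _ id hne
  simp only [Finset.mem_filter, Finset.mem_univ, true_and, id] at hj hmax
  refine ⟨j, hj, ?_⟩
  have hj' : j ∉ Finset.univ.filter (fun i : Fin d => i < j) := by simp
  rw [leftEnd, add_comm, ← Finset.sum_insert hj']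
  by_cases hlast : (j : ℕ) + 1 < d
  · have hlt : x < leftEnd L ⟨j + 1, hlast⟩ := by
      by_contra! hle
      have := hmax _ hle
      rw [Fin.le_def] at this
      simp at this
    refine hlt.trans_eq (Finset.sum_congr ?_ fun _ _ => rfl)
    ext i
    simp only [Finset.mem_insert, Finset.mem_filter, Finset.mem_univ, true_and, Fin.lt_def,
      Fin.ext_iff]
    omega
  · refine h1.trans_eq (Finset.sum_congr ?_ fun _ _ => rfl)
    ext i
    simp only [Finset.mem_insert, Finset.mem_filter, Finset.mem_univ, true_and, Fin.lt_def,
      Fin.ext_iff, true_iff]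
    omega

lemma leftEnd_nonneg {L : Fin d → ℝ} (hL : ∀ i, 0 ≤ L i) (j : Fin d) : 0 ≤ leftEnd L j :=
  Finset.sum_nonneg fun i _ => hL i

lemma leftEnd_add_le_sum {L : Fin d → ℝ} (hL : ∀ i, 0 ≤ L i) (j : Fin d) :
    leftEnd L j + L j ≤ ∑ i, L i := by
  have hj' : j ∉ Finset.univ.filter (fun i : Fin d => i < j) := by simp
  rw [leftEnd, add_comm, ← Finset.sum_insert hj']
  exact Finset.sum_le_sum_of_subset_of_nonneg (Finset.subset_univ _) (fun i _ _ => hL i)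

lemma leftEnd_injective {L : Fin d → ℝ} (hL : ∀ i, 0 < L i) :
    Function.Injective (leftEnd L) := fun i j h =>
  eq_of_mem_Ico_leftEnd (fun i => (hL i).le) (x := leftEnd L i)
    ⟨le_rfl, by linarith [hL i]⟩ ⟨h.ge, by linarith [hL j]⟩

end Intervals

section Map

variable {d : ℕ} (π : Equiv.Perm (Fin d))

/-- Left endpoint of the image under `T_{L,π}` of the `j`-th interval. -/
noncomputable def imageLeftEnd (L : Fin d → ℝ) (j : Fin d) : ℝ :=
  ∑ k ∈ Finset.univ.filter (fun k => π k < π j), L k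

lemma imageLeftEnd_eq (L : Fin d → ℝ) (j : Fin d) :
    imageLeftEnd π L j = leftEnd (L ∘ π.symm) (π j) := by
  refine Finset.sum_equiv π (fun i => ?_) (fun i _ => ?_) <;> simp

variable {π}

lemma ietMap_of_mem {L : Fin d → ℝ} (hL : ∀ i, 0 ≤ L i) {x : ℝ} {j : Fin d}
    (hx : x ∈ Set.Ico (leftEnd L j) (leftEnd L j + L j)) :
    ietMap π L x = x - leftEnd L j + imageLeftEnd π L j := by
  have h : ∃ j : Fin d, x ∈ Set.Ico (leftEnd L j) (leftEnd L j + L j) := ⟨j, hx⟩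
  have hj : h.choose = j := eq_of_mem_Ico_leftEnd hL h.choose_spec hx
  rw [ietMap, dif_pos h, hj, imageLeftEnd]

lemma ietMap_of_notMem {L : Fin d → ℝ} {x : ℝ}
    (hx : ¬ ∃ j, x ∈ Set.Ico (leftEnd L j) (leftEnd L j + L j)) :
    ietMap π L x = x := dif_neg hx

lemma ietMap_mem_image {L : Fin d → ℝ} (hL : ∀ i, 0 ≤ L i) {x : ℝ} {j : Fin d}
    (hx : x ∈ Set.Ico (leftEnd L j) (leftEnd L j + L j)) :
    ietMap π L x ∈ Set.Ico (leftEnd (L ∘ π.symm) (π j))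
      (leftEnd (L ∘ π.symm) (π j) + (L ∘ π.symm) (π j)) := by
  rw [ietMap_of_mem hL hx, imageLeftEnd_eq]
  simp only [Function.comp, Equiv.symm_apply_apply]
  constructor <;> linarith [hx.1, hx.2]

lemma ietMap_injective {L : Fin d → ℝ} (hL : ∀ i, 0 ≤ L i) :
    Function.Injective (ietMap π L) := by
  have hL' : ∀ i, 0 ≤ (L ∘ π.symm) i := fun i => hL _
  have hmixed : ∀ {x y : ℝ} {j : Fin d},
      x ∈ Set.Ico (leftEnd L j) (leftEnd L j + L j) →
      (¬ ∃ k, y ∈ Set.Ico (leftEnd L k) (leftEnd L k + L k)) →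
      ietMap π L x ≠ ietMap π L y := by
    intro x y j hx hy hxy
    rw [ietMap_of_notMem hy] at hxy
    have hm := ietMap_mem_image (π := π) hL hx
    rw [hxy] at hm
    refine hy (exists_mem_Ico_leftEnd ((leftEnd_nonneg hL' _).trans hm.1) ?_)
    refine (hm.2.trans_le (leftEnd_add_le_sum hL' _)).trans_eq ?_
    exact Equiv.sum_comp π.symm L
  intro x y hxy
  by_cases hx : ∃ j, x ∈ Set.Ico (leftEnd L j) (leftEnd L j + L j)
  · obtain ⟨j, hx⟩ := hx
    by_cases hy : ∃ j, y ∈ Set.Ico (leftEnd L j) (leftEnd L j + L j)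
    · obtain ⟨k, hy⟩ := hy
      have hjk : j = k := π.injective
        (eq_of_mem_Ico_leftEnd hL' (hxy ▸ ietMap_mem_image hL hx) (ietMap_mem_image hL hy))
      subst hjk
      rw [ietMap_of_mem hL hx, ietMap_of_mem hL hy] at hxy
      linarith
    · exact absurd hxy (hmixed hx hy)
  · by_cases hy : ∃ j, y ∈ Set.Ico (leftEnd L j) (leftEnd L j + L j)
    · obtain ⟨k, hy⟩ := hy
      exact absurd hxy.symm (hmixed hy hx)
    · rwa [ietMap_of_notMem hx, ietMap_of_notMem hy] at hxy

lemma ietMap_leftEnd {L : Fin d → ℝ} (hL : ∀ i, 0 < L i) (i : Fin d) :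
    ietMap π L (leftEnd L i) = imageLeftEnd π L i := by
  rw [ietMap_of_mem (fun i => (hL i).le) (j := i) ⟨le_rfl, by linarith [hL i]⟩]
  ring

/-- The displacement of an iterate is a combination of the translation lengths with natural
number coefficients (the numbers of visits to the exchanged intervals). -/
lemma exists_iterate_ietMap_eq {L : Fin d → ℝ} (hL : ∀ i, 0 ≤ L i) (m : ℕ) (x : ℝ) :
    ∃ n : Fin d → ℕ, (ietMap π L)^[m] x =
      x + ∑ k, (n k : ℝ) * (imageLeftEnd π L k - leftEnd L k) := by
  induction m with
  | zero => exact ⟨0, by simp⟩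
  | succ m ih =>
    obtain ⟨n, hn⟩ := ih
    rw [Function.iterate_succ_apply']
    set y := (ietMap π L)^[m] x
    by_cases hy : ∃ j, y ∈ Set.Ico (leftEnd L j) (leftEnd L j + L j)
    · obtain ⟨j, hy⟩ := hy
      refine ⟨n + Pi.single j 1, ?_⟩
      rw [ietMap_of_mem hL hy]
      simp only [Pi.add_apply, Nat.cast_add, add_mul, Finset.sum_add_distrib, Pi.single_apply,
        Nat.cast_ite, Nat.cast_one, Nat.cast_zero, ite_mul, one_mul, zero_mul,
        Finset.sum_ite_eq', Finset.mem_univ, if_true]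
      linarith
    · exact ⟨n, by rw [ietMap_of_notMem hy, hn]⟩

end Map

section Combinatorics

variable {d : ℕ} {π : Equiv.Perm (Fin d)}

lemma IsIrreducible.eq_of_antitone (hirr : IsIrreducible π) {b : Fin d → ℤ}
    (hb : Antitone b) (hbπ : Antitone (b ∘ π)) (hd : 0 < d) (p : Fin d) : b p = b ⟨0, hd⟩ := by
  have hinv : b ∘ π = b := by
    have := Tuple.unique_monotone (f := fun i => -b i) (σ := π) (τ := Equiv.refl _)
      (fun i j h => neg_le_neg (hbπ h)) (fun i j h => neg_le_neg (hb h))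
    funext i
    have := congrFun this i
    simpa using this
  by_contra hp
  have hex : ∃ k : ℕ, ∃ h : k < d, b ⟨k, h⟩ ≠ b ⟨0, hd⟩ := ⟨p, p.2, hp⟩
  classical
  obtain ⟨hk, hbk⟩ := Nat.find_spec hex
  have hmin := fun l => Nat.find_min hex (m := l)
  set k := Nat.find hex
  have hset : ∀ j : Fin d, (j : ℕ) < k ↔ b j = b ⟨0, hd⟩ := by
    intro j
    refine ⟨fun hj => ?_, fun hj => ?_⟩
    · by_contra hne
      exact hmin j hj ⟨j.2, hne⟩
    · by_contra! hkj
      have h1 : b j ≤ b ⟨k, hk⟩ := hb (Fin.le_def.2 hkj)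
      have h2 : b ⟨k, hk⟩ ≤ b ⟨0, hd⟩ := hb (Fin.le_def.2 (Nat.zero_le _))
      exact hbk (le_antisymm h2 (hj.symm.le.trans h1))
  have hk0 : 0 < k := by
    rw [Nat.pos_iff_ne_zero]
    intro h0
    exact hbk (by congr)
  refine hirr k hk0 hk ?_
  ext j
  simp only [Set.mem_image, Set.mem_ofPred_eq, hset]
  constructor
  · rintro ⟨i, hi, rfl⟩
    exact (congrFun hinv i).trans hi
  · intro hj
    refine ⟨π.symm j, ?_, by simp⟩
    rw [← hj, ← congrFun hinv (π.symm j)]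
    simp

/-- The sums of two nonnegative weights over the final segments determined by `p` and `π p`
cannot agree for every `p`, unless the first weight is concentrated at the first index. -/
lemma IsIrreducible.weight_eq_zero (hirr : IsIrreducible π) {u v : Fin d → ℤ}
    (hu : 0 ≤ u) (hv : 0 ≤ v)
    (huv : ∀ p, ∑ k, u k * (if p < k then 1 else 0) = ∑ k, v k * (if π p < π k then 1 else 0))
    {j : Fin d} (hj : (j : ℕ) ≠ 0) : u j = 0 := by
  have hd : 0 < d := j.pos
  set a : Fin d → ℤ := fun p => ∑ k, u k * (if p < k then 1 else 0)
  set b : Fin d → ℤ := fun q => ∑ k, v k * (if q < π k then 1 else 0)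
  have hab : b ∘ π = a := funext fun p => (huv p).symm
  have ha : Antitone a := by
    intro p q hpq
    refine Finset.sum_le_sum fun k _ => mul_le_mul_of_nonneg_left ?_ (hu k)
    split_ifs with h1 h2 <;> first | exact absurd (hpq.trans_lt h1) h2 | norm_num
  have hb : Antitone b := by
    intro p q hpq
    refine Finset.sum_le_sum fun k _ => mul_le_mul_of_nonneg_left ?_ (hv k)
    split_ifs with h1 h2 <;> first | exact absurd (hpq.trans_lt h1) h2 | norm_num
  have hconst := hirr.eq_of_antitone hb (hab ▸ ha) hd
  have ha_const : ∀ p q, a p = a q := fun p q => by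
    rw [← hab, Function.comp, Function.comp, hconst, ← hconst (π q)]
  have hlast : a ⟨d - 1, by omega⟩ = 0 := by
    refine Finset.sum_eq_zero fun k _ => ?_
    rw [if_neg, mul_zero]
    rw [Fin.lt_def]
    have := k.2
    simp only
    omega
  have hzero : a ⟨0, hd⟩ = 0 := (ha_const _ _).trans hlast
  have hterm := (Finset.sum_eq_zero_iff_of_nonneg (fun k _ => mul_nonneg (hu k)
    (by split_ifs <;> norm_num))).1 hzero j (Finset.mem_univ j)
  rw [if_pos (Fin.lt_def.2 (Nat.pos_of_ne_zero hj))] at hterm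
  simpa using hterm

end Combinatorics

section RationalIndependence

variable {d : ℕ} {π : Equiv.Perm (Fin d)}

lemma leftEnd_eq_sum_ite (L : Fin d → ℝ) (j : Fin d) :
    leftEnd L j = ∑ p, (if p < j then 1 else 0) * L p := by
  simp [leftEnd, Finset.sum_filter]

lemma imageLeftEnd_eq_sum_ite (L : Fin d → ℝ) (j : Fin d) :
    imageLeftEnd π L j = ∑ p, (if π p < π j then 1 else 0) * L p := by
  simp [imageLeftEnd, Finset.sum_filter]

lemma iterate_succ_leftEnd_ne (hirr : IsIrreducible π) {L : Fin d → ℝ} (hL : ∀ i, 0 < L i)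
    (hind : ∀ c : Fin d → ℤ, c ≠ 0 → ∑ p, (c p : ℝ) * L p ≠ 0)
    (i : Fin d) {j : Fin d} (hj : (j : ℕ) ≠ 0) (m : ℕ) :
    (ietMap π L)^[m + 1] (leftEnd L i) ≠ leftEnd L j := by
  intro h
  rw [Function.iterate_succ_apply, ietMap_leftEnd hL] at h
  obtain ⟨n, hn⟩ := exists_iterate_ietMap_eq (π := π) (fun i => (hL i).le) m
    (imageLeftEnd π L i)
  rw [hn] at h
  set u : Fin d → ℤ := fun k => (n k : ℤ) + if k = j then 1 else 0 with hu_def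
  set v : Fin d → ℤ := fun k => (n k : ℤ) + if k = i then 1 else 0 with hv_def
  set c : Fin d → ℤ := fun p => ∑ k, v k * (if π p < π k then 1 else 0) -
    ∑ k, u k * (if p < k then 1 else 0) with hc_def
  have hv_sum : ∑ k, (v k : ℝ) * imageLeftEnd π L k =
      ∑ k, (n k : ℝ) * imageLeftEnd π L k + imageLeftEnd π L i := by
    simp [hv_def, add_mul, Finset.sum_add_distrib]
  have hu_sum : ∑ k, (u k : ℝ) * leftEnd L k =
      ∑ k, (n k : ℝ) * leftEnd L k + leftEnd L j := by
    simp [hu_def, add_mul, Finset.sum_add_distrib]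
  have hc_sum : ∑ p, (c p : ℝ) * L p =
      ∑ k, (v k : ℝ) * imageLeftEnd π L k - ∑ k, (u k : ℝ) * leftEnd L k := by
    simp only [imageLeftEnd_eq_sum_ite, leftEnd_eq_sum_ite, Finset.mul_sum]
    rw [Finset.sum_comm, Finset.sum_comm (f := fun k p => (u k : ℝ) * _),
      ← Finset.sum_sub_distrib]
    refine Finset.sum_congr rfl fun p _ => ?_
    simp only [hc_def]
    push_cast
    rw [sub_mul, Finset.sum_mul, Finset.sum_mul]
    simp only [mul_assoc]
  have hc : c = 0 := by
    by_contra hne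
    refine hind c hne ?_
    simp only [mul_sub, Finset.sum_sub_distrib] at h
    rw [hc_sum, hv_sum, hu_sum]
    linarith
  have hu : 0 ≤ u := fun k => by simp only [hu_def, Pi.zero_apply]; positivity
  have hv : 0 ≤ v := fun k => by simp only [hv_def, Pi.zero_apply]; positivity
  have huj := hirr.weight_eq_zero hu hv (fun p => (sub_eq_zero.1 (congrFun hc p)).symm) hj
  simp only [hu_def, if_true] at huj
  omega

lemma keaneCondition_of_rationally_independent (hirr : IsIrreducible π) {L : Fin d → ℝ}
    (hL : ∀ i, 0 < L i) (hind : ∀ c : Fin d → ℤ, c ≠ 0 → ∑ p, (c p : ℝ) * L p ≠ 0) :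
    KeaneCondition π L := by
  have key : ∀ i j : Fin d, (j : ℕ) ≠ 0 → ∀ m n : ℕ, n ≤ m →
      (ietMap π L)^[m] (leftEnd L i) = (ietMap π L)^[n] (leftEnd L j) → i = j ∧ m = n := by
    intro i j hj m n hnm h
    obtain ⟨r, rfl⟩ := Nat.exists_eq_add_of_le hnm
    rw [Function.iterate_add_apply] at h
    have h' := (ietMap_injective (π := π) fun i => (hL i).le).iterate n h
    cases r with
    | zero => exact ⟨leftEnd_injective hL h', rfl⟩
    | succ r => exact absurd h' (iterate_succ_leftEnd_ne hirr hL hind i hj r)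
  intro i j hi hj m n h
  rcases le_total n m with hnm | hnm
  · exact key i j hj m n hnm h
  · obtain ⟨h1, h2⟩ := key j i hi n m hnm h.symm
    exact ⟨h1.symm, h2.symm⟩

end RationalIndependence

section Topology

variable {X : Type*} [TopologicalSpace X]

/-- `f` agrees with continuous functions on the pieces of a countable cover of `X` by sets
whose complements are Gδ. -/
def IsPiecewiseContinuous (f : X → ℝ) : Prop :=
  ∃ (ι : Type) (_ : Countable ι) (A : ι → Set X) (g : ι → X → ℝ),
    (∀ k, IsGδ (A k)ᶜ) ∧ (∀ k, Continuous (g k)) ∧ (∀ x, ∃ k, x ∈ A k) ∧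
    ∀ k, ∀ x ∈ A k, f x = g k x

lemma Continuous.isPiecewiseContinuous {f : X → ℝ} (hf : Continuous f) :
    IsPiecewiseContinuous f :=
  ⟨Unit, inferInstance, fun _ => Set.univ, fun _ => f, by simp, fun _ => hf, by simp, by simp⟩

lemma IsPiecewiseContinuous.isGδ_ne {f g : X → ℝ} (hf : IsPiecewiseContinuous f)
    (hg : IsPiecewiseContinuous g) : IsGδ {x | f x ≠ g x} := by
  obtain ⟨ι, _, A, φ, hA, hφ, hAc, hAf⟩ := hf
  obtain ⟨κ, _, B, ψ, hB, hψ, hBc, hBg⟩ := hg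
  have : {x | f x ≠ g x} =
      ⋂ k, ⋂ l, ((A k)ᶜ ∪ (B l)ᶜ ∪ {x | φ k x ≠ ψ l x}) := by
    ext x
    simp only [Set.mem_ofPred_eq, Set.mem_iInter, Set.mem_union, Set.mem_compl_iff]
    constructor
    · intro h k l
      by_cases hk : x ∈ A k
      · by_cases hl : x ∈ B l
        · right
          rwa [← hAf k x hk, ← hBg l x hl]
        · exact Or.inl (Or.inr hl)
      · exact Or.inl (Or.inl hk)
    · intro h
      obtain ⟨k, hk⟩ := hAc x
      obtain ⟨l, hl⟩ := hBc x
      rw [hAf k x hk, hBg l x hl]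
      rcases h k l with (h | h) | h
      · exact absurd hk h
      · exact absurd hl h
      · exact h
  rw [this]
  exact .iInter fun k => .iInter fun l =>
    ((hA k).union (hB l)).union (isOpen_ne_fun (hφ k) (hψ l)).isGδ

end Topology

section Simplex

variable {d : ℕ} {π : Equiv.Perm (Fin d)}

@[fun_prop]
lemma continuous_coord (i : Fin d) :
    Continuous fun L : stdSimplex ℝ (Fin d) => (L : Fin d → ℝ) i :=
  (continuous_apply i).comp continuous_subtype_val

@[fun_prop]
lemma continuous_leftEnd (j : Fin d) :
    Continuous fun L : stdSimplex ℝ (Fin d) => leftEnd (L : Fin d → ℝ) j :=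
  continuous_finsetSum _ fun i _ => continuous_coord i

@[fun_prop]
lemma continuous_imageLeftEnd (j : Fin d) :
    Continuous fun L : stdSimplex ℝ (Fin d) => imageLeftEnd π (L : Fin d → ℝ) j :=
  continuous_finsetSum _ fun i _ => continuous_coord i

lemma IsPiecewiseContinuous.comp_ietMap {f : stdSimplex ℝ (Fin d) → ℝ}
    (hf : IsPiecewiseContinuous f) :
    IsPiecewiseContinuous fun L : stdSimplex ℝ (Fin d) => ietMap π (L : Fin d → ℝ) (f L) := by
  obtain ⟨ι, _, A, φ, hA, hφ, hAc, hAf⟩ := hf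
  set I : ι → Fin d → Set (stdSimplex ℝ (Fin d)) := fun k j =>
    {L | leftEnd (L : Fin d → ℝ) j ≤ φ k L} ∩
      {L | φ k L < leftEnd (L : Fin d → ℝ) j + (L : Fin d → ℝ) j} with hI
  have hclosed : ∀ k j, IsClosed {L : stdSimplex ℝ (Fin d) |
      leftEnd (L : Fin d → ℝ) j ≤ φ k L} := fun k j => by
    have := hφ k
    exact isClosed_le (by fun_prop) this
  have hopen : ∀ k j, IsOpen {L : stdSimplex ℝ (Fin d) |
      φ k L < leftEnd (L : Fin d → ℝ) j + (L : Fin d → ℝ) j} := fun k j => by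
    have := hφ k
    exact isOpen_lt this (by fun_prop)
  refine ⟨ι × Option (Fin d), inferInstance,
    fun k => A k.1 ∩ k.2.elim ((⋃ j, I k.1 j)ᶜ : Set (stdSimplex ℝ (Fin d))) (I k.1),
    fun k (L : stdSimplex ℝ (Fin d)) => k.2.elim (φ k.1 L)
      (fun j => φ k.1 L - leftEnd (L : Fin d → ℝ) j + imageLeftEnd π (L : Fin d → ℝ) j),
    ?_, ?_, ?_, ?_⟩
  · rintro ⟨k, _ | j⟩
    · simp only [Option.elim, Set.compl_inter, compl_compl]
      exact (hA k).union (.iUnion fun j => (hclosed k j).isGδ.inter (hopen k j).isGδ)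
    · simp only [Option.elim, Set.compl_inter, hI]
      exact (hA k).union ((hclosed k j).isOpen_compl.isGδ.union (hopen k j).isClosed_compl.isGδ)
  · rintro ⟨k, _ | j⟩
    · exact hφ k
    · have := hφ k
      simp only [Option.elim]
      fun_prop
  · intro L
    obtain ⟨k, hk⟩ := hAc L
    by_cases h : L ∈ ⋃ j, I k j
    · obtain ⟨j, hj⟩ := Set.mem_iUnion.1 h
      exact ⟨(k, some j), hk, hj⟩
    · exact ⟨(k, none), hk, h⟩
  · rintro ⟨k, _ | j⟩ L ⟨hk, hL⟩
    · simp only [Option.elim, hAf k L hk]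
      refine ietMap_of_notMem fun ⟨j, hj⟩ => hL (Set.mem_iUnion.2 ⟨j, hj.1, hj.2⟩)
    · simp only [Option.elim, hAf k L hk]
      exact ietMap_of_mem L.2.1 ⟨hL.1, hL.2⟩

lemma isPiecewiseContinuous_iterate_leftEnd (i : Fin d) (m : ℕ) :
    IsPiecewiseContinuous fun L : stdSimplex ℝ (Fin d) =>
      (ietMap π (L : Fin d → ℝ))^[m] (leftEnd (L : Fin d → ℝ) i) := by
  induction m with
  | zero => exact Continuous.isPiecewiseContinuous (continuous_leftEnd i)
  | succ m ih =>
    simp only [Function.iterate_succ_apply']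
    exact ih.comp_ietMap

lemma isGδ_keaneCondition :
    IsGδ {L : stdSimplex ℝ (Fin d) | KeaneCondition π (L : Fin d → ℝ)} := by
  have : {L : stdSimplex ℝ (Fin d) | KeaneCondition π (L : Fin d → ℝ)} =
      ⋂ (i : Fin d) (j : Fin d) (_ : (i : ℕ) ≠ 0) (_ : (j : ℕ) ≠ 0) (m : ℕ) (n : ℕ)
        (_ : ¬ (i = j ∧ m = n)), {L : stdSimplex ℝ (Fin d) |
          (ietMap π (L : Fin d → ℝ))^[m] (leftEnd (L : Fin d → ℝ) i) ≠
            (ietMap π (L : Fin d → ℝ))^[n] (leftEnd (L : Fin d → ℝ) j)} := by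
    ext L
    simp only [KeaneCondition, Set.mem_ofPred_eq, Set.mem_iInter]
    exact ⟨fun h i j hi hj m n hne heq => hne (h i j hi hj m n heq),
      fun h i j hi hj m n heq => by_contra fun hne => h i j hi hj m n hne heq⟩
  rw [this]
  exact .iInter fun i => .iInter fun j => .iInter fun _ => .iInter fun _ => .iInter fun m =>
    .iInter fun n => .iInter fun _ => (isPiecewiseContinuous_iterate_leftEnd i m).isGδ_ne
      (isPiecewiseContinuous_iterate_leftEnd j n)

lemma isOpen_sum_mul_ne_zero (c : Fin d → ℤ) :
    IsOpen {L : stdSimplex ℝ (Fin d) | ∑ p, (c p : ℝ) * (L : Fin d → ℝ) p ≠ 0} :=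
  isOpen_ne_fun (continuous_finsetSum _ fun i _ => continuous_const.mul (continuous_coord i))
    continuous_const

lemma dense_sum_mul_ne_zero {c : Fin d → ℤ} (hc : c ≠ 0) :
    Dense {L : stdSimplex ℝ (Fin d) | ∑ p, (c p : ℝ) * (L : Fin d → ℝ) p ≠ 0} := by
  obtain ⟨q, hq⟩ := Function.ne_iff.1 hc
  intro L
  by_cases hL : ∑ p, (c p : ℝ) * (L : Fin d → ℝ) p = 0
  swap
  · exact subset_closure hL
  have hmem : ∀ t : Set.Icc (0 : ℝ) 1,
      (1 - (t : ℝ)) • (L : Fin d → ℝ) + (t : ℝ) • Pi.single q 1 ∈ stdSimplex ℝ (Fin d) :=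
    fun t => convex_stdSimplex ℝ (Fin d) L.2 (single_mem_stdSimplex ℝ q)
      (by linarith [t.2.2]) t.2.1 (by ring)
  set F : Set.Icc (0 : ℝ) 1 → stdSimplex ℝ (Fin d) := fun t => ⟨_, hmem t⟩ with hF
  have hcont : Continuous F := by
    refine Continuous.subtype_mk ?_ _
    fun_prop
  have hF0 : F 0 = L := by
    apply Subtype.ext
    simp only [hF, Set.Icc.coe_zero, sub_zero, one_smul, zero_smul, add_zero]
    rfl
  have hdense : (0 : Set.Icc (0 : ℝ) 1) ∈ closure {t | t ≠ 0} := by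
    have : Dense ({0}ᶜ : Set (Set.Icc (0 : ℝ) 1)) := dense_compl_singleton _
    exact this 0
  rw [← hF0]
  refine map_mem_closure hcont hdense fun t ht => ?_
  have hval : ∑ p, (c p : ℝ) * (F t : Fin d → ℝ) p = t * c q := by
    change ∑ p, (c p : ℝ) * ((1 - (t : ℝ)) * (L : Fin d → ℝ) p +
      (t : ℝ) * (Pi.single q 1 : Fin d → ℝ) p) = t * c q
    have h1 : ∑ p, (c p : ℝ) * ((1 - (t : ℝ)) * (L : Fin d → ℝ) p) = 0 := by
      refine Eq.trans ?_ ((congrArg ((1 - (t : ℝ)) * ·) hL).trans (mul_zero _))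
      rw [Finset.mul_sum]
      exact Finset.sum_congr rfl fun p _ => mul_left_comm _ _ _
    simp only [mul_add, Finset.sum_add_distrib]
    rw [h1, zero_add]
    simp [Pi.single_apply, mul_comm]
  rw [Set.mem_ofPred_eq, hval]
  refine mul_ne_zero (fun h => ht (Subtype.ext h)) ?_
  exact_mod_cast hq

end Simplex

/-- For `d ≥ 2` and any irreducible permutation `π` of `{1,…,d}`, the
set of `L ∈ Δ_{d-1}` with strictly positive entries such that `T_{L,π}` satisfies
the Keane condition is a Gδ subset of `Δ_{d-1}` and contains a dense Gδ subset. -/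
theorem keane_condition_residual {d : ℕ} (hd : 2 ≤ d) (π : Equiv.Perm (Fin d))
    (hirr : IsIrreducible π) :
    IsGδ {L : stdSimplex ℝ (Fin d) |
        (∀ i, 0 < (L : Fin d → ℝ) i) ∧ KeaneCondition π (L : Fin d → ℝ)} ∧
    ∃ G : Set (stdSimplex ℝ (Fin d)), IsGδ G ∧ Dense G ∧
      G ⊆ {L : stdSimplex ℝ (Fin d) |
        (∀ i, 0 < (L : Fin d → ℝ) i) ∧ KeaneCondition π (L : Fin d → ℝ)} := by
  constructor
  · refine IsGδ.inter ?_ isGδ_keaneCondition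
    have : {L : stdSimplex ℝ (Fin d) | ∀ i, 0 < (L : Fin d → ℝ) i} =
        ⋂ i, {L : stdSimplex ℝ (Fin d) | 0 < (L : Fin d → ℝ) i} := by
      ext L; simp
    change IsGδ {L : stdSimplex ℝ (Fin d) | ∀ i, 0 < (L : Fin d → ℝ) i}
    rw [this]
    exact .iInter fun i => (isOpen_lt continuous_const (continuous_coord i)).isGδ
  · refine ⟨⋂ c : {c : Fin d → ℤ // c ≠ 0}, {L : stdSimplex ℝ (Fin d) |
      ∑ p, (c.1 p : ℝ) * (L : Fin d → ℝ) p ≠ 0},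
      .iInter fun c => (isOpen_sum_mul_ne_zero c.1).isGδ, ?_, fun L hL => ?_⟩
    · have : CompactSpace (stdSimplex ℝ (Fin d)) :=
        isCompact_iff_compactSpace.1 (isCompact_stdSimplex ℝ (Fin d))
      exact dense_iInter_of_isOpen (fun c => isOpen_sum_mul_ne_zero c.1)
        fun c => dense_sum_mul_ne_zero c.2
    · rw [Set.mem_iInter] at hL
      have hind : ∀ c : Fin d → ℤ, c ≠ 0 → ∑ p, (c p : ℝ) * (L : Fin d → ℝ) p ≠ 0 :=
        fun c hc => hL ⟨c, hc⟩
      have hpos : ∀ i, 0 < (L : Fin d → ℝ) i := fun i => by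
        refine lt_of_le_of_ne (L.2.1 i) fun h => ?_
        refine hind (Pi.single i 1) (by simp) ?_
        simp [Pi.single_apply, ← h]
      exact ⟨hpos, keaneCondition_of_rationally_independent hirr hpos hind⟩

end IETPaper
end
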